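/- Case 16 of Theorem 1.2 (proved via the highest and second highest root group criterion): the hypergeometric group Γ(f,g) generated by the companion matrices A and B of f(x) = x^5 - 3x^4 + 5x^3 - 5x^2 + 3x - 1 and g(x) = x^5 + 2x^4 + 3x^3 + 3x^2 + 2x + 1 is an arithmetic subgroup of the integral orthogonal group O_Q(ℤ): Γ(f,g) is contained in O_Q(ℤ) (in particular Aᵀ·Q·A = Q and Bᵀ·Q·B = Q), and Γ(f,g) has finite index in O_Q(ℤ). -/

import Mathlib

open Matrix

/-- The companion matrix `A` of `f(x) = x^5 - 3*x^4 + 5*x^3 - 5*x^2 + 3*x - 1`. -/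
def matA : Matrix (Fin 5) (Fin 5) ℤ :=
  !![(0 : ℤ), 0, 0, 0, 1; 1, 0, 0, 0, -3; 0, 1, 0, 0, 5; 0, 0, 1, 0, -5; 0, 0, 0, 1, 3]

/-- The companion matrix `B` of `g(x) = x^5 + 2*x^4 + 3*x^3 + 3*x^2 + 2*x + 1`. -/
def matB : Matrix (Fin 5) (Fin 5) ℤ :=
  !![(0 : ℤ), 0, 0, 0, -1; 1, 0, 0, 0, -2; 0, 1, 0, 0, -3; 0, 0, 1, 0, -3; 0, 0, 0, 1, -2]

/-- The symmetric integer matrix `Q` of the quadratic form preserved by `Γ(f,g)`. -/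
def matQ : Matrix (Fin 5) (Fin 5) ℤ :=
  !![(13 : ℤ), 2, -14, -7, 22; 2, 13, 2, -14, -7; -14, 2, 13, 2, -14; -7, -14, 2, 13, 2; 22, -7, -14, 2, 13]

/-- The integral orthogonal group `O_Q(ℤ)` of a matrix `Q`, as the subgroup of `GL₅(ℤ)`
consisting of all `M` with `Mᵀ * Q * M = Q`. -/
def orthogonalSubgroup (Q : Matrix (Fin 5) (Fin 5) ℤ) : Subgroup (GL (Fin 5) ℤ) where
  carrier := { M : GL (Fin 5) ℤ |
      (M : Matrix (Fin 5) (Fin 5) ℤ)ᵀ * Q * (M : Matrix (Fin 5) (Fin 5) ℤ) = Q }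
  one_mem' := by simp
  mul_mem' := by
    intro a b ha hb
    simp only [Set.mem_setOf_eq, Units.val_mul, transpose_mul] at ha hb ⊢
    calc ((b : Matrix (Fin 5) (Fin 5) ℤ)ᵀ * (a : Matrix (Fin 5) (Fin 5) ℤ)ᵀ) * Q *
          ((a : Matrix (Fin 5) (Fin 5) ℤ) * (b : Matrix (Fin 5) (Fin 5) ℤ))
        = (b : Matrix (Fin 5) (Fin 5) ℤ)ᵀ *
            ((a : Matrix (Fin 5) (Fin 5) ℤ)ᵀ * Q * (a : Matrix (Fin 5) (Fin 5) ℤ)) *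
            (b : Matrix (Fin 5) (Fin 5) ℤ) := by
          simp only [mul_assoc]
      _ = Q := by rw [ha, hb]
  inv_mem' := by
    intro a ha
    simp only [Set.mem_setOf_eq] at ha ⊢
    calc ((a⁻¹ : GL (Fin 5) ℤ) : Matrix (Fin 5) (Fin 5) ℤ)ᵀ * Q *
          ((a⁻¹ : GL (Fin 5) ℤ) : Matrix (Fin 5) (Fin 5) ℤ)
        = ((a⁻¹ : GL (Fin 5) ℤ) : Matrix (Fin 5) (Fin 5) ℤ)ᵀ *
            ((a : Matrix (Fin 5) (Fin 5) ℤ)ᵀ * Q * (a : Matrix (Fin 5) (Fin 5) ℤ)) *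
            ((a⁻¹ : GL (Fin 5) ℤ) : Matrix (Fin 5) (Fin 5) ℤ) := by rw [ha]
      _ = ((a : Matrix (Fin 5) (Fin 5) ℤ) *
            ((a⁻¹ : GL (Fin 5) ℤ) : Matrix (Fin 5) (Fin 5) ℤ))ᵀ * Q *
          ((a : Matrix (Fin 5) (Fin 5) ℤ) *
            ((a⁻¹ : GL (Fin 5) ℤ) : Matrix (Fin 5) (Fin 5) ℤ)) := by
          simp only [transpose_mul, mul_assoc]
      _ = Q := by rw [Units.mul_inv]; simp


namespace HGA

abbrev M5 := Matrix (Fin 5) (Fin 5) ℤ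
abbrev G5 := GL (Fin 5) ℤ
abbrev SL2 := Matrix.SpecialLinearGroup (Fin 2) ℤ

/-! ### Integer vectors of length five as a plain structure -/

/-- Column vectors with five integer entries. -/
@[ext] structure V5 where
  x1 : ℤ
  x2 : ℤ
  w : ℤ
  y2 : ℤ
  y1 : ℤ

instance : DecidableEq V5 := fun a b =>
  decidable_of_iff (a.x1 = b.x1 ∧ a.x2 = b.x2 ∧ a.w = b.w ∧ a.y2 = b.y2 ∧ a.y1 = b.y1) (by
    constructor
    · rintro h
      cases a
      cases b
      simp_all
    · rintro rfl
      simp)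

/-- The underlying function of a vector. -/
def V5.vec (v : V5) : Fin 5 → ℤ := ![v.x1, v.x2, v.w, v.y2, v.y1]

theorem vec_inj {v w : V5} (h : v.vec = w.vec) : v = w := by
  have h0 := congrFun h 0
  have h1 := congrFun h 1
  have h2 := congrFun h 2
  have h3 := congrFun h 3
  have h4 := congrFun h 4
  simp [V5.vec] at h0 h1 h2 h3 h4
  ext <;> assumption

theorem vec_surj (f : Fin 5 → ℤ) : (V5.mk (f 0) (f 1) (f 2) (f 3) (f 4)).vec = f := by
  ext i; fin_cases i <;> rfl

/-- `M` acts on vectors through the function `f`. -/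
def Acts (M : M5) (f : V5 → V5) : Prop := ∀ v : V5, M *ᵥ v.vec = (f v).vec

theorem Acts.mul {M N : M5} {f g : V5 → V5} (h : Acts M f) (k : Acts N g) :
    Acts (M * N) (fun v => f (g v)) := by
  intro v
  rw [← Matrix.mulVec_mulVec, k v, h]

theorem acts_one : Acts (1 : M5) (fun v => v) := by
  intro v; simp

theorem Acts.ext {M N : M5} {f g : V5 → V5} (h : Acts M f) (k : Acts N g)
    (hfg : ∀ v, f v = g v) : M = N := by
  apply Matrix.mulVec_injective
  funext f'
  rw [← vec_surj f', h, k, hfg]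

theorem Acts.congr {M : M5} {f g : V5 → V5} (h : Acts M f) (hfg : ∀ v, f v = g v) :
    Acts M g := by
  intro v; rw [h, hfg]

/-- The basis vectors. -/
def eb (j : Fin 5) : V5 :=
  ![⟨1, 0, 0, 0, 0⟩, ⟨0, 1, 0, 0, 0⟩, ⟨0, 0, 1, 0, 0⟩, ⟨0, 0, 0, 1, 0⟩, ⟨0, 0, 0, 0, 1⟩] j

theorem eb_vec (j : Fin 5) : (eb j).vec = Pi.single j 1 := by
  fin_cases j <;> (ext i; fin_cases i <;> rfl)

theorem Acts.ext_basis {M N : M5} {f g : V5 → V5} (h : Acts M f) (k : Acts N g)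
    (hfg : ∀ j, f (eb j) = g (eb j)) : M = N := by
  ext i j
  have := h (eb j)
  rw [hfg, ← k, eb_vec, Matrix.mulVec_single_one, Matrix.mulVec_single_one] at this
  exact congrFun this i

/-! ### The four root `SL₂` -/

/-- `SL₂` acting on the plane `e₁, e₂`. -/
def aS1 (a b c d : ℤ) (v : V5) : V5 :=
  ⟨a * v.x1 + b * v.x2, c * v.x1 + d * v.x2, v.w, a * v.y2 - b * v.y1, d * v.y1 - c * v.y2⟩

/-- `SL₂` acting on the plane `e₁, f₂`. -/
def aS2 (a b c d : ℤ) (v : V5) : V5 :=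
  ⟨a * v.x1 + b * v.y2, a * v.x2 - b * v.y1, v.w, c * v.x1 + d * v.y2, d * v.y1 - c * v.x2⟩

/-- `SL₂` acting on `e₁, z, f₁` by conjugation of traceless matrices. -/
def aL1 (a b c d : ℤ) (v : V5) : V5 :=
  ⟨a * a * v.x1 - 2 * a * b * v.w - b * b * v.y1, v.x2,
    (a * d + b * c) * v.w + b * d * v.y1 - a * c * v.x1, v.y2,
    d * d * v.y1 + 2 * c * d * v.w - c * c * v.x1⟩

/-- `SL₂` acting on `e₂, z, f₂` by conjugation of traceless matrices. -/
def aL2 (a b c d : ℤ) (v : V5) : V5 :=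
  ⟨v.x1, a * a * v.x2 - 2 * a * b * v.w - b * b * v.y2,
    (a * d + b * c) * v.w + b * d * v.y2 - a * c * v.x2,
    d * d * v.y2 + 2 * c * d * v.w - c * c * v.x2, v.y1⟩

/-- The matrix attached to a function on vectors. -/
def matOf (f : V5 → V5) : M5 := Matrix.of fun i j => (f (eb j)).vec i

theorem acts_aS1 (a b c d : ℤ) : Acts (matOf (aS1 a b c d)) (aS1 a b c d) := by
  intro v; ext i
  fin_cases i <;> simp [matOf, aS1, eb, V5.vec, Matrix.mulVec, dotProduct, Fin.sum_univ_five] <;> ring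

theorem acts_aS2 (a b c d : ℤ) : Acts (matOf (aS2 a b c d)) (aS2 a b c d) := by
  intro v; ext i
  fin_cases i <;> simp [matOf, aS2, eb, V5.vec, Matrix.mulVec, dotProduct, Fin.sum_univ_five] <;> ring

theorem acts_aL1 (a b c d : ℤ) : Acts (matOf (aL1 a b c d)) (aL1 a b c d) := by
  intro v; ext i
  fin_cases i <;> simp [matOf, aL1, eb, V5.vec, Matrix.mulVec, dotProduct, Fin.sum_univ_five] <;> ring

theorem acts_aL2 (a b c d : ℤ) : Acts (matOf (aL2 a b c d)) (aL2 a b c d) := by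
  intro v; ext i
  fin_cases i <;> simp [matOf, aL2, eb, V5.vec, Matrix.mulVec, dotProduct, Fin.sum_univ_five] <;> ring

/-- A multiplicative four-parameter family of actions gives a homomorphism from `SL₂`. -/
def homOf (f : ℤ → ℤ → ℤ → ℤ → V5 → V5)
    (hf : ∀ a b c d, Acts (matOf (f a b c d)) (f a b c d))
    (h1 : ∀ v, f 1 0 0 1 v = v)
    (hm : ∀ a b c d a' b' c' d' v, f a b c d (f a' b' c' d' v) =
      f (a * a' + b * c') (a * b' + b * d') (c * a' + d * c') (c * b' + d * d') v) :
    SL2 →* G5 :=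
  MonoidHom.toHomUnits
    { toFun := fun g => matOf (f (g 0 0) (g 0 1) (g 1 0) (g 1 1))
      map_one' := by
        apply (hf _ _ _ _).ext acts_one
        intro v
        simpa using h1 v
      map_mul' := by
        intro g g'
        apply (hf _ _ _ _).ext ((hf _ _ _ _).mul (hf _ _ _ _))
        intro v
        rw [hm]
        simp [Matrix.mul_apply, Fin.sum_univ_two] }

theorem homOf_acts (f : ℤ → ℤ → ℤ → ℤ → V5 → V5) (hf h1 hm) (g : SL2) :
    Acts (homOf f hf h1 hm g : M5) (f (g 0 0) (g 0 1) (g 1 0) (g 1 1)) := hf _ _ _ _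

def hS1 : SL2 →* G5 := homOf aS1 acts_aS1 (by intro v; simp [aS1])
  (by intros; ext <;> simp only [aS1] <;> ring)
def hS2 : SL2 →* G5 := homOf aS2 acts_aS2 (by intro v; simp [aS2])
  (by intros; ext <;> simp only [aS2] <;> ring)
def hL1 : SL2 →* G5 := homOf aL1 acts_aL1 (by intro v; simp [aL1])
  (by intros; ext <;> simp only [aL1] <;> ring)
def hL2 : SL2 →* G5 := homOf aL2 acts_aL2 (by intro v; simp [aL2])
  (by intros; ext <;> simp only [aL2] <;> ring)

theorem hS1_acts (g : SL2) : Acts (hS1 g : M5) (aS1 (g 0 0) (g 0 1) (g 1 0) (g 1 1)) :=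
  homOf_acts _ _ _ _ g
theorem hS2_acts (g : SL2) : Acts (hS2 g : M5) (aS2 (g 0 0) (g 0 1) (g 1 0) (g 1 1)) :=
  homOf_acts _ _ _ _ g
theorem hL1_acts (g : SL2) : Acts (hL1 g : M5) (aL1 (g 0 0) (g 0 1) (g 1 0) (g 1 1)) :=
  homOf_acts _ _ _ _ g
theorem hL2_acts (g : SL2) : Acts (hL2 g : M5) (aL2 (g 0 0) (g 0 1) (g 1 0) (g 1 1)) :=
  homOf_acts _ _ _ _ g

/-- Upper unipotent. -/
def up (n : ℤ) : SL2 := ⟨!![1, n; 0, 1], by simp⟩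
/-- Lower unipotent. -/
def lo (n : ℤ) : SL2 := ⟨!![1, 0; n, 1], by simp⟩

theorem det_eq (g : SL2) : g 0 0 * g 1 1 - g 0 1 * g 1 0 = 1 := by
  have := g.det_coe
  rwa [Matrix.det_fin_two] at this

theorem up_add (m n : ℤ) : up (m + n) = up m * up n := by
  apply Subtype.ext
  rw [Matrix.SpecialLinearGroup.coe_mul]
  simp [up, add_comm]

theorem lo_add (m n : ℤ) : lo (m + n) = lo m * lo n := by
  apply Subtype.ext
  rw [Matrix.SpecialLinearGroup.coe_mul]
  simp [lo]

end HGA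

namespace HGA

/-! ### Finite index through finite covers -/

theorem finiteIndex_of_coloring {S : Type*} [Group S] (H : Subgroup S) {κ : Type*} [Finite κ]
    (c : S → κ) (h : ∀ s t, c s = c t → s * t⁻¹ ∈ H) : H.FiniteIndex := by
  have : Finite (S ⧸ H) := by
    apply Finite.of_injective (fun q : S ⧸ H => c (q.out)⁻¹)
    intro p q hpq
    have := h _ _ hpq
    rw [inv_inv] at this
    rw [← QuotientGroup.out_eq' p, ← QuotientGroup.out_eq' q]
    exact QuotientGroup.eq.mpr this
  exact Subgroup.finiteIndex_of_finite_quotient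

theorem finiteIndex_of_cover {S G : Type*} [Group S] [Group G] (Γ : Subgroup G) (φ : S →* G)
    (Z : Set G) (hZ : Z.Finite) (h : ∀ g, ∃ z ∈ Z, φ g * z⁻¹ ∈ Γ) :
    (Γ.comap φ).FiniteIndex := by
  choose c hc hc' using h
  have : Finite Z := hZ
  apply finiteIndex_of_coloring _ (fun g => (⟨c g, hc g⟩ : Z))
  intro s t hst
  have hst' : c s = c t := congrArg Subtype.val hst
  rw [Subgroup.mem_comap, map_mul, map_inv]
  have := Γ.mul_mem (hc' s) (Γ.inv_mem (hc' t))
  rw [hst'] at this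
  simpa using this

/-- A three-parameter unipotent family normalized by a homomorphism. -/
structure Par (φ : SL2 →* G5) (u : ℤ → ℤ → ℤ → G5) (κ : ℤ) : Prop where
  one : u 0 0 0 = 1
  mul : ∀ a b c a' b' c', u a b c * u a' b' c' = u (a + a') (b + b') (c + c' + κ * a' * b)
  conj : ∀ g a b c, ∃ a' b' c', u a b c * φ g = φ g * u a' b' c'

variable {φ : SL2 →* G5} {u : ℤ → ℤ → ℤ → G5} {κ : ℤ}

theorem Par.inv (hp : Par φ u κ) (a b c : ℤ) : (u a b c)⁻¹ = u (-a) (-b) (κ * a * b - c) := by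
  rw [inv_eq_iff_mul_eq_one, hp.mul, ← hp.one]
  congr 1 <;> ring

/-- The elements of `SL₂` that can be completed to an element of `Γ`. -/
def Par.P (hp : Par φ u κ) (Γ : Subgroup G5) : Subgroup SL2 where
  carrier := {g | ∃ a b c, φ g * u a b c ∈ Γ}
  one_mem' := ⟨0, 0, 0, by rw [hp.one]; simp [Γ.one_mem]⟩
  mul_mem' := by
    rintro g g' ⟨a, b, c, h⟩ ⟨a', b', c', h'⟩
    obtain ⟨a1, b1, c1, h1⟩ := hp.conj g' a b c
    refine ⟨a1 + a', b1 + b', c1 + c' + κ * a' * b1, ?_⟩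
    have := Γ.mul_mem h h'
    rw [← hp.mul, map_mul]
    convert this using 1
    rw [mul_assoc (φ g), ← mul_assoc (φ g'), ← h1]
    simp only [mul_assoc]
  inv_mem' := by
    rintro g ⟨a, b, c, h⟩
    obtain ⟨a1, b1, c1, h1⟩ := hp.conj g⁻¹ (-a) (-b) (κ * a * b - c)
    refine ⟨a1, b1, c1, ?_⟩
    have := Γ.inv_mem h
    rwa [_root_.mul_inv_rev, hp.inv, ← map_inv, h1] at this

theorem Par.mem_P (hp : Par φ u κ) {Γ : Subgroup G5} {g : SL2} :
    g ∈ hp.P Γ ↔ ∃ a b c, φ g * u a b c ∈ Γ := Iff.rfl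

theorem zmul_mem {G : Type*} [Group G] (Γ : Subgroup G) (x : ℤ → G)
    (hx : ∀ m n, x (m + n) = x m * x n) (N : ℤ) (hN : x N ∈ Γ) (k : ℤ) : x (N * k) ∈ Γ := by
  let f : Multiplicative ℤ →* G := MonoidHom.mk' (fun m => x m.toAdd) (by intro a b; exact hx _ _)
  have h : x (N * k) = (x N) ^ k := by
    have := map_zpow f (Multiplicative.ofAdd N) k
    rw [← ofAdd_zsmul] at this
    simpa [f, mul_comm] using this
  rw [h]
  exact Γ.zpow_mem hN k

theorem Par.cover (hp : Par φ u κ) (Γ : Subgroup G5) (N : ℤ) (hN : 0 < N)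
    (h1 : u N 0 0 ∈ Γ) (h2 : u 0 N 0 ∈ Γ) (h3 : u 0 0 N ∈ Γ) :
    ∃ Z : Set G5, Z.Finite ∧ ∀ a b c, ∃ z ∈ Z, u a b c * z⁻¹ ∈ Γ := by
  refine ⟨Set.image (fun t : ℤ × ℤ × ℤ => u t.1 t.2.1 t.2.2)
    (Set.Ico 0 N ×ˢ (Set.Ico 0 N ×ˢ Set.Ico 0 N)), ?_, ?_⟩
  · exact ((Set.finite_Ico 0 N).prod ((Set.finite_Ico 0 N).prod (Set.finite_Ico 0 N))).image _
  · intro a b c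
    have k1 := fun k => zmul_mem Γ (fun n => u n 0 0) (by intro m n; simp [hp.mul]) N h1 k
    have k2 := fun k => zmul_mem Γ (fun n => u 0 n 0) (by intro m n; simp [hp.mul]) N h2 k
    have k3 := fun k => zmul_mem Γ (fun n => u 0 0 n) (by intro m n; simp [hp.mul]) N h3 k
    set c' := c - κ * (a % N) * (N * (b / N)) with hc'
    refine ⟨u (a % N) (b % N) (c' % N), ⟨(a % N, b % N, c' % N), ?_, rfl⟩, ?_⟩
    · simp only [Set.mem_prod, Set.mem_Ico]
      exact ⟨⟨Int.emod_nonneg _ hN.ne', Int.emod_lt_of_pos _ hN⟩,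
        ⟨Int.emod_nonneg _ hN.ne', Int.emod_lt_of_pos _ hN⟩,
        ⟨Int.emod_nonneg _ hN.ne', Int.emod_lt_of_pos _ hN⟩⟩
    · have e : u a b c = (u (N * (a / N)) 0 0 * u 0 (N * (b / N)) 0 * u 0 0 (N * (c' / N))) *
          u (a % N) (b % N) (c' % N) := by
        simp only [hp.mul]
        congr 1
        · have := Int.emod_add_mul_ediv a N; linarith
        · have := Int.emod_add_mul_ediv b N; linarith
        · have := Int.emod_add_mul_ediv c' N
          linear_combination hc' - this
      rw [e, mul_inv_cancel_right]
      exact Γ.mul_mem (Γ.mul_mem (k1 _) (k2 _)) (k3 _)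

theorem Par.finiteIndex (hp : Par φ u κ) (Γ : Subgroup G5) (N : ℤ) (hN : 0 < N)
    (h1 : u N 0 0 ∈ Γ) (h2 : u 0 N 0 ∈ Γ) (h3 : u 0 0 N ∈ Γ)
    (R : Set SL2) (hR : R.Finite) (hPR : ∀ g, ∃ r ∈ R, g * r⁻¹ ∈ hp.P Γ) :
    (Γ.comap φ).FiniteIndex := by
  obtain ⟨Z, hZ, hZ'⟩ := hp.cover Γ N hN h1 h2 h3
  apply finiteIndex_of_cover Γ φ (Set.image2 (fun z r => z * φ r) Z R) (hZ.image2 _ hR)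
  intro g
  obtain ⟨r, hr, a, b, c, hg⟩ := hPR g
  obtain ⟨z, hz, hzz⟩ := hZ' (-a) (-b) (κ * a * b - c)
  refine ⟨z * φ r, ⟨z, hz, r, hr, rfl⟩, ?_⟩
  rw [← hp.inv] at hzz
  have := Γ.mul_mem hg hzz
  convert this using 1
  rw [map_mul, map_inv]
  group

/-! ### Coset tables in `SL₂(ℤ)` -/

theorem table_cover (P : Subgroup SL2) (R : Set SL2) (h1 : 1 ∈ R)
    (hS : ∀ r ∈ R, ∃ r' ∈ R, r * ModularGroup.S * r'⁻¹ ∈ P)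
    (hT : ∀ r ∈ R, ∃ r' ∈ R, r * ModularGroup.T * r'⁻¹ ∈ P) (g : SL2) :
    ∃ r ∈ R, g * r⁻¹ ∈ P := by
  let W : Submonoid SL2 :=
    { carrier := {g | ∀ r ∈ R, ∃ r' ∈ R, r * g * r'⁻¹ ∈ P}
      one_mem' := by
        intro r hr
        exact ⟨r, hr, by simp [P.one_mem]⟩
      mul_mem' := by
        intro a b ha hb r hr
        obtain ⟨r1, hr1, h1⟩ := ha r hr
        obtain ⟨r2, hr2, h2⟩ := hb r1 hr1
        refine ⟨r2, hr2, ?_⟩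
        have := P.mul_mem h1 h2
        convert this using 1
        group }
  have wS : ModularGroup.S ∈ W := hS
  have wT : ModularGroup.T ∈ W := hT
  have wS' : (ModularGroup.S)⁻¹ ∈ W := by
    have : (ModularGroup.S)⁻¹ = ModularGroup.S * ModularGroup.S * ModularGroup.S := by decide
    rw [this]
    exact W.mul_mem (W.mul_mem wS wS) wS
  have wT' : (ModularGroup.T)⁻¹ ∈ W := by
    have : (ModularGroup.T)⁻¹ = ModularGroup.S * ModularGroup.T * ModularGroup.S *
      ModularGroup.T * (ModularGroup.S)⁻¹ := by decide
    rw [this]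
    exact W.mul_mem (W.mul_mem (W.mul_mem (W.mul_mem wS wT) wS) wT) wS'
  have hg : g ∈ W := by
    have hg : g ∈ Subgroup.closure {ModularGroup.S, ModularGroup.T} := by
      rw [SpecialLinearGroup.SL2Z_generators]; trivial
    induction hg using Subgroup.closure_induction'' with
    | one => exact W.one_mem
    | mem x hx => rcases hx with rfl | rfl <;> assumption
    | inv_mem x hx => rcases hx with rfl | rfl <;> assumption
    | mul x y _ _ hx hy => exact W.mul_mem hx hy
  simpa using hg 1 h1

/-- Plain two by two integer matrices. -/
structure M2 where
  a : ℤ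
  b : ℤ
  c : ℤ
  d : ℤ

instance : DecidableEq M2 := fun a b =>
  decidable_of_iff (a.a = b.a ∧ a.b = b.b ∧ a.c = b.c ∧ a.d = b.d) (by
    constructor
    · rintro h
      cases a
      cases b
      simp_all
    · rintro rfl
      simp)

def M2.det (m : M2) : ℤ := m.a * m.d - m.b * m.c
def M2.mul (m n : M2) : M2 :=
  ⟨m.a * n.a + m.b * n.c, m.a * n.b + m.b * n.d, m.c * n.a + m.d * n.c, m.c * n.b + m.d * n.d⟩
def M2.adj (m : M2) : M2 := ⟨m.d, -m.b, -m.c, m.a⟩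
def M2.neg (m : M2) : M2 := ⟨-m.a, -m.b, -m.c, -m.d⟩

/-- The element of `SL₂(ℤ)` given by a matrix of determinant one. -/
def M2.sl (m : M2) : SL2 :=
  if h : m.det = 1 then ⟨!![m.a, m.b; m.c, m.d], by rw [Matrix.det_fin_two_of]; exact h⟩ else 1

theorem M2.det_mul (m n : M2) : (m.mul n).det = m.det * n.det := by
  simp only [M2.mul, M2.det]; ring
theorem M2.det_adj (m : M2) : m.adj.det = m.det := by
  simp only [M2.adj, M2.det]; ring
theorem M2.det_neg (m : M2) : m.neg.det = m.det := by
  simp only [M2.neg, M2.det]; ring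

theorem M2.sl_val {m : M2} (h : m.det = 1) : (m.sl).1 = !![m.a, m.b; m.c, m.d] := by
  simp [M2.sl, h]

theorem M2.sl_mul {m n : M2} (hm : m.det = 1) (hn : n.det = 1) :
    (m.mul n).sl = m.sl * n.sl := by
  apply Subtype.ext
  rw [Matrix.SpecialLinearGroup.coe_mul, M2.sl_val hm, M2.sl_val hn,
    M2.sl_val (by rw [M2.det_mul, hm, hn]; rfl)]
  simp [M2.mul]

theorem M2.sl_adj {m : M2} (hm : m.det = 1) : (m.adj).sl = (m.sl)⁻¹ := by
  apply Subtype.ext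
  rw [Matrix.SpecialLinearGroup.coe_inv, M2.sl_val hm, M2.sl_val (by rw [M2.det_adj, hm]),
    Matrix.adjugate_fin_two_of]
  simp [M2.adj]

theorem M2.sl_neg {m : M2} (hm : m.det = 1) : (m.neg).sl = -(m.sl) := by
  apply Subtype.ext
  rw [Matrix.SpecialLinearGroup.coe_neg, M2.sl_val hm, M2.sl_val (by rw [M2.det_neg, hm])]
  simp [M2.neg]

/-- Membership of a plain matrix in a subgroup of `SL₂(ℤ)`. -/
def InP (P : Subgroup SL2) (m : M2) : Prop := m.det = 1 ∧ m.sl ∈ P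

theorem InP.mul {P : Subgroup SL2} {m n : M2} (hm : InP P m) (hn : InP P n) :
    InP P (m.mul n) :=
  ⟨by rw [M2.det_mul, hm.1, hn.1]; rfl, by rw [M2.sl_mul hm.1 hn.1]; exact P.mul_mem hm.2 hn.2⟩

theorem InP.adj {P : Subgroup SL2} {m : M2} (hm : InP P m) : InP P m.adj :=
  ⟨by rw [M2.det_adj, hm.1], by rw [M2.sl_adj hm.1]; exact P.inv_mem hm.2⟩

theorem InP.neg {P : Subgroup SL2} (hneg : (-1 : SL2) ∈ P) {m : M2} (hm : InP P m) :
    InP P m.neg := by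
  refine ⟨by rw [M2.det_neg, hm.1], ?_⟩
  rw [M2.sl_neg hm.1, ← neg_one_mul]
  exact P.mul_mem hneg hm.2

theorem InP.of_neg {P : Subgroup SL2} (hneg : (-1 : SL2) ∈ P) {m : M2} (hm : InP P m.neg) :
    InP P m := by
  have := hm.neg hneg
  rcases m with ⟨a, b, c, d⟩
  simpa [M2.neg] using this

theorem InP.of_adj {P : Subgroup SL2} {m : M2} (hm : InP P m.adj) : InP P m := by
  have := hm.adj
  rcases m with ⟨a, b, c, d⟩
  simpa [M2.adj] using this

def M2.one : M2 := ⟨1, 0, 0, 1⟩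
theorem InP.one (P : Subgroup SL2) : InP P M2.one := by
  refine ⟨rfl, ?_⟩
  have : M2.one.sl = 1 := by decide
  rw [this]; exact P.one_mem

/-- One step of a straight line program: multiply two earlier entries or their inverses. -/
def slStep (L : List M2) (t : ℕ × Bool × ℕ × Bool) : List M2 :=
  let x := L.getD t.1 M2.one
  let y := L.getD t.2.2.1 M2.one
  L ++ [(if t.2.1 then x else x.adj).mul (if t.2.2.2 then y else y.adj)]

theorem slStep_mem {P : Subgroup SL2} {L : List M2} (hL : ∀ m ∈ L, InP P m)
    (t : ℕ × Bool × ℕ × Bool) : ∀ m ∈ slStep L t, InP P m := by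
  have key : ∀ i, InP P (L.getD i M2.one) := by
    intro i
    by_cases h : i < L.length
    · rw [List.getD_eq_getElem _ _ h]; exact hL _ (List.getElem_mem h)
    · rw [List.getD_eq_default _ _ (by omega)]; exact InP.one P
  intro m hm
  simp only [slStep, List.mem_append, List.mem_singleton] at hm
  rcases hm with hm | rfl
  · exact hL m hm
  · apply InP.mul
    · split
      · exact key _
      · exact (key _).adj
    · split
      · exact key _
      · exact (key _).adj

theorem slRun_mem {P : Subgroup SL2} (I : List (ℕ × Bool × ℕ × Bool)) {L : List M2}
    (hL : ∀ m ∈ L, InP P m) : ∀ m ∈ I.foldl slStep L, InP P m := by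
  induction I generalizing L with
  | nil => exact hL
  | cons t I ih => exact ih (slStep_mem hL t)

/-- Lookup of a matrix up to sign and inversion. -/
def look (L : List M2) (x : M2) : Bool :=
  x == M2.one || x.neg == M2.one || L.any (fun l => l == x || l == x.neg || l == x.adj || l == x.adj.neg)

theorem look_mem {P : Subgroup SL2} (hneg : (-1 : SL2) ∈ P) {L : List M2}
    (hL : ∀ m ∈ L, InP P m) {x : M2} (h : look L x = true) : InP P x := by
  simp only [look, Bool.or_eq_true, beq_iff_eq, List.any_eq_true] at h
  rcases h with (h | h) | ⟨l, hl, h⟩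
  · rw [h]; exact InP.one P
  · exact InP.of_neg hneg (h ▸ InP.one P)
  · have := hL l hl
    rcases h with ((h | h) | h) | h
    · exact h ▸ this
    · exact InP.of_neg hneg (h ▸ this)
    · exact InP.of_adj (h ▸ this)
    · exact InP.of_adj (InP.of_neg hneg (h ▸ this))

def mS : M2 := ⟨0, -1, 1, 0⟩
def mT : M2 := ⟨1, 1, 0, 1⟩

/-- The coset table check: `reps` are the representatives, each with the indices of its
translates by `S` and `T`. -/
def tableOK (L reps : List M2) (tgt : List (ℕ × ℕ)) : Bool :=
  reps.contains M2.one && reps.all (fun r => r.det == 1) &&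
  (reps.zip tgt).all (fun p =>
    look L ((p.1.mul mS).mul (reps.getD p.2.1 M2.one).adj) &&
    look L ((p.1.mul mT).mul (reps.getD p.2.2 M2.one).adj)) && reps.length == tgt.length

theorem tableOK_cover {P : Subgroup SL2} (hneg : (-1 : SL2) ∈ P) {L reps : List M2}
    {tgt : List (ℕ × ℕ)} (hL : ∀ m ∈ L, InP P m) (h : tableOK L reps tgt = true) :
    ∃ R : Set SL2, R.Finite ∧ ∀ g, ∃ r ∈ R, g * r⁻¹ ∈ P := by
  simp only [tableOK, Bool.and_eq_true, List.all_eq_true, beq_iff_eq, List.contains_iff_mem] at h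
  obtain ⟨⟨⟨h1, hdet⟩, hz⟩, hlen⟩ := h
  refine ⟨Set.image M2.sl {r | r ∈ reps}, (List.finite_toSet reps).image _, ?_⟩
  have key : ∀ i, reps.getD i M2.one ∈ reps := by
    intro i
    by_cases h : i < reps.length
    · rw [List.getD_eq_getElem _ _ h]; exact List.getElem_mem h
    · rw [List.getD_eq_default _ _ (by omega)]; exact h1
  have eS : mS.sl = ModularGroup.S := by decide
  have eT : mT.sl = ModularGroup.T := by decide
  have main : ∀ r ∈ reps, (∃ r' ∈ reps, InP P ((r.mul mS).mul r'.adj)) ∧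
      (∃ r' ∈ reps, InP P ((r.mul mT).mul r'.adj)) := by
    intro r hr
    obtain ⟨i, hi, rfl⟩ := List.getElem_of_mem hr
    have hi' : i < (reps.zip tgt).length := by simp [List.length_zip]; omega
    have := hz _ (List.getElem_mem hi')
    rw [List.getElem_zip] at this
    exact ⟨⟨_, key _, look_mem hneg hL this.1⟩, ⟨_, key _, look_mem hneg hL this.2⟩⟩
  apply table_cover
  · exact ⟨M2.one, h1, by decide⟩
  · rintro _ ⟨r, hr, rfl⟩
    obtain ⟨r', hr', h'⟩ := (main r hr).1
    refine ⟨r'.sl, ⟨r', hr', rfl⟩, ?_⟩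
    have d1 := hdet r hr
    have d2 := hdet r' hr'
    have := h'.2
    rwa [M2.sl_mul (by rw [M2.det_mul, d1]; rfl) (by rw [M2.det_adj, d2]), M2.sl_mul d1 rfl,
      M2.sl_adj d2, eS] at this
  · rintro _ ⟨r, hr, rfl⟩
    obtain ⟨r', hr', h'⟩ := (main r hr).2
    refine ⟨r'.sl, ⟨r', hr', rfl⟩, ?_⟩
    have d1 := hdet r hr
    have d2 := hdet r' hr'
    have := h'.2
    rwa [M2.sl_mul (by rw [M2.det_mul, d1]; rfl) (by rw [M2.det_adj, d2]), M2.sl_mul d1 rfl,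
      M2.sl_adj d2, eT] at this

end HGA

namespace HGA

theorem hS1_up (n : ℤ) : Acts (hS1 (up n) : M5) (aS1 1 n 0 1) := hS1_acts (up n)
theorem hS2_up (n : ℤ) : Acts (hS2 (up n) : M5) (aS2 1 n 0 1) := hS2_acts (up n)
theorem hL1_up (n : ℤ) : Acts (hL1 (up n) : M5) (aL1 1 n 0 1) := hL1_acts (up n)
theorem hL2_up (n : ℤ) : Acts (hL2 (up n) : M5) (aL2 1 n 0 1) := hL2_acts (up n)
theorem hS1_lo (n : ℤ) : Acts (hS1 (lo n) : M5) (aS1 1 0 n 1) := hS1_acts (lo n)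
theorem hS2_lo (n : ℤ) : Acts (hS2 (lo n) : M5) (aS2 1 0 n 1) := hS2_acts (lo n)
theorem hL1_lo (n : ℤ) : Acts (hL1 (lo n) : M5) (aL1 1 0 n 1) := hL1_acts (lo n)
theorem hL2_lo (n : ℤ) : Acts (hL2 (lo n) : M5) (aL2 1 0 n 1) := hL2_acts (lo n)

/-! ### The unipotent radicals -/

def uL2 (a b c : ℤ) : G5 := hS1 (up a) * hL1 (up b) * hS2 (up c)
def uS1 (a b c : ℤ) : G5 := hL1 (up a) * hL2 (up b) * hS2 (up c)
def uS2 (a b c : ℤ) : G5 := hL1 (up a) * hL2 (lo b) * hS1 (up c)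
def uL1 (a b c : ℤ) : G5 := hS1 (up a) * hL2 (lo b) * hS2 (lo c)

theorem uL2_acts (a b c : ℤ) :
    Acts (uL2 a b c : M5) (fun v => aS1 1 a 0 1 (aL1 1 b 0 1 (aS2 1 c 0 1 v))) :=
  ((hS1_up a).mul (hL1_up b)).mul (hS2_up c)
theorem uS1_acts (a b c : ℤ) :
    Acts (uS1 a b c : M5) (fun v => aL1 1 a 0 1 (aL2 1 b 0 1 (aS2 1 c 0 1 v))) :=
  ((hL1_up a).mul (hL2_up b)).mul (hS2_up c)
theorem uS2_acts (a b c : ℤ) :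
    Acts (uS2 a b c : M5) (fun v => aL1 1 a 0 1 (aL2 1 0 b 1 (aS1 1 c 0 1 v))) :=
  ((hL1_up a).mul (hL2_lo b)).mul (hS1_up c)
theorem uL1_acts (a b c : ℤ) :
    Acts (uL1 a b c : M5) (fun v => aS1 1 a 0 1 (aL2 1 0 b 1 (aS2 1 0 c 1 v))) :=
  ((hS1_up a).mul (hL2_lo b)).mul (hS2_lo c)

theorem acts_eq {g h : G5} {f k : V5 → V5} (hg : Acts (g : M5) f) (hh : Acts (h : M5) k)
    (e : ∀ v, f v = k v) : g = h := Units.ext (hg.ext hh e)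

theorem acts_mul {g h : G5} {f k : V5 → V5} (hg : Acts (g : M5) f) (hh : Acts (h : M5) k) :
    Acts ((g * h : G5) : M5) (fun v => f (k v)) := hg.mul hh

theorem acts_oneG : Acts ((1 : G5) : M5) (fun v => v) := acts_one

theorem parL2 : Par hL2 uL2 0 where
  one := by
    refine acts_eq (uL2_acts _ _ _) acts_oneG ?_
    intro v; ext <;> simp [aS1, aS2, aL1]
  mul := by
    intro a b c a' b' c'
    refine acts_eq (acts_mul (uL2_acts _ _ _) (uL2_acts _ _ _)) (uL2_acts _ _ _) ?_
    intro v; ext <;> simp only [aS1, aS2, aL1] <;> ring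
  conj := by
    intro g a b c
    have hd := det_eq g
    generalize hp : g 0 0 = p at hd
    generalize hq : g 0 1 = q at hd
    generalize hr : g 1 0 = r at hd
    generalize hs : g 1 1 = s at hd
    refine ⟨p ^ 2 * a + 2 * r * p * b - r ^ 2 * c, (p * s + q * r) * b + p * q * a - r * s * c,
      s ^ 2 * c - 2 * s * q * b - q ^ 2 * a, ?_⟩
    refine acts_eq (acts_mul (uL2_acts _ _ _) (hL2_acts g))
      (acts_mul (hL2_acts g) (uL2_acts _ _ _)) ?_
    rw [hp, hq, hr, hs]
    intro v; ext <;> simp only [aS1, aS2, aL1, aL2] <;> grind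

theorem parL1 : Par hL1 uL1 0 where
  one := by
    refine acts_eq (uL1_acts _ _ _) acts_oneG ?_
    intro v; ext <;> simp [aS1, aS2, aL2]
  mul := by
    intro a b c a' b' c'
    refine acts_eq (acts_mul (uL1_acts _ _ _) (uL1_acts _ _ _)) (uL1_acts _ _ _) ?_
    intro v; ext <;> simp only [aS1, aS2, aL2] <;> ring
  conj := by
    intro g a b c
    have hd := det_eq g
    generalize hp : g 0 0 = p at hd
    generalize hq : g 0 1 = q at hd
    generalize hr : g 1 0 = r at hd
    generalize hs : g 1 1 = s at hd
    refine ⟨s ^ 2 * a - 2 * s * q * b + q ^ 2 * c, (p * s + q * r) * b - p * q * c - r * s * a,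
      p ^ 2 * c - 2 * r * p * b + r ^ 2 * a, ?_⟩
    refine acts_eq (acts_mul (uL1_acts _ _ _) (hL1_acts g))
      (acts_mul (hL1_acts g) (uL1_acts _ _ _)) ?_
    rw [hp, hq, hr, hs]
    intro v; ext <;> simp only [aS1, aS2, aL1, aL2] <;> grind

theorem parS1 : Par hS1 uS1 2 where
  one := by
    refine acts_eq (uS1_acts _ _ _) acts_oneG ?_
    intro v; ext <;> simp [aL1, aS2, aL2]
  mul := by
    intro a b c a' b' c'
    refine acts_eq (acts_mul (uS1_acts _ _ _) (uS1_acts _ _ _)) (uS1_acts _ _ _) ?_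
    intro v; ext <;> simp only [aL1, aS2, aL2] <;> ring
  conj := by
    intro g a b c
    have hd := det_eq g
    generalize hp : g 0 0 = p at hd
    generalize hq : g 0 1 = q at hd
    generalize hr : g 1 0 = r at hd
    generalize hs : g 1 1 = s at hd
    refine ⟨s * a - q * b, p * b - r * a, c - a * b + (s * a - q * b) * (p * b - r * a), ?_⟩
    refine acts_eq (acts_mul (uS1_acts _ _ _) (hS1_acts g))
      (acts_mul (hS1_acts g) (uS1_acts _ _ _)) ?_
    rw [hp, hq, hr, hs]
    intro v; ext <;> simp only [aS1, aS2, aL1, aL2] <;> grind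

theorem parS2 : Par hS2 uS2 (-2) where
  one := by
    refine acts_eq (uS2_acts _ _ _) acts_oneG ?_
    intro v; ext <;> simp [aL1, aS1, aL2]
  mul := by
    intro a b c a' b' c'
    refine acts_eq (acts_mul (uS2_acts _ _ _) (uS2_acts _ _ _)) (uS2_acts _ _ _) ?_
    intro v; ext <;> simp only [aL1, aS1, aL2] <;> ring
  conj := by
    intro g a b c
    have hd := det_eq g
    generalize hp : g 0 0 = p at hd
    generalize hq : g 0 1 = q at hd
    generalize hr : g 1 0 = r at hd
    generalize hs : g 1 1 = s at hd
    refine ⟨s * a + q * b, p * b + r * a, c + a * b - (s * a + q * b) * (p * b + r * a), ?_⟩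
    refine acts_eq (acts_mul (uS2_acts _ _ _) (hS2_acts g))
      (acts_mul (hS2_acts g) (uS2_acts _ _ _)) ?_
    rw [hp, hq, hr, hs]
    intro v; ext <;> simp only [aS1, aS2, aL1, aL2] <;> grind

end HGA

namespace HGA

/-! ### Words in the generators -/

def actA (v : V5) : V5 :=
  ⟨v.y1, v.x1 - 3 * v.y1, v.x2 + 5 * v.y1, v.w - 5 * v.y1, v.y2 + 3 * v.y1⟩
def actAi (v : V5) : V5 :=
  ⟨v.x2 + 3 * v.x1, v.w - 5 * v.x1, v.y2 + 5 * v.x1, v.y1 - 3 * v.x1, v.x1⟩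
def actB (v : V5) : V5 :=
  ⟨-v.y1, v.x1 - 2 * v.y1, v.x2 - 3 * v.y1, v.w - 3 * v.y1, v.y2 - 2 * v.y1⟩
def actBi (v : V5) : V5 :=
  ⟨v.x2 - 2 * v.x1, v.w - 3 * v.x1, v.y2 - 3 * v.x1, v.y1 - 2 * v.x1, -v.x1⟩

/-- Iterate `f` or its inverse. -/
def powAct (f g : V5 → V5) : ℤ → V5 → V5
  | Int.ofNat n, v => f^[n] v
  | Int.negSucc n, v => g^[n + 1] v

/-- The action of a word `A^k₁ B^k₂ A^k₃ ⋯` (starting with `B` if the flag is `false`). -/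
def actW : List ℤ → Bool → V5 → V5
  | [], _, v => v
  | k :: ks, true, v => powAct actA actAi k (actW ks false v)
  | k :: ks, false, v => powAct actB actBi k (actW ks true v)

def wordG (A B : G5) : List ℤ → Bool → G5
  | [], _ => 1
  | k :: ks, true => A ^ k * wordG A B ks false
  | k :: ks, false => B ^ k * wordG A B ks true

theorem acts_iter {A : G5} {f : V5 → V5} (hf : Acts (A : M5) f) (n : ℕ) :
    Acts ((A ^ n : G5) : M5) (f^[n]) := by
  induction n with
  | zero => exact acts_oneG
  | succ n ih =>
    rw [pow_succ]
    exact (acts_mul ih hf).congr (fun v => rfl)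

theorem acts_inv {A : G5} {f g : V5 → V5} (hf : Acts (A : M5) f) (hfg : ∀ v, f (g v) = v) :
    Acts ((A⁻¹ : G5) : M5) g := by
  intro v
  have h := hf (g v)
  rw [hfg] at h
  rw [← h, Matrix.mulVec_mulVec]
  simp

theorem acts_powAct {A : G5} {f g : V5 → V5} (hf : Acts (A : M5) f) (hfg : ∀ v, f (g v) = v)
    (k : ℤ) : Acts ((A ^ k : G5) : M5) (powAct f g k) := by
  rcases k with n | n
  · rw [Int.ofNat_eq_natCast, zpow_natCast]
    exact (acts_iter hf n).congr (fun v => rfl)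
  · rw [zpow_negSucc, ← inv_pow]
    exact (acts_iter (acts_inv hf hfg) (n + 1)).congr (fun v => rfl)

theorem acts_matA : Acts matA actA := by
  intro v; ext i
  fin_cases i <;> simp [matA, actA, V5.vec, Matrix.mulVec, dotProduct, Fin.sum_univ_five] <;> ring

theorem acts_matB : Acts matB actB := by
  intro v; ext i
  fin_cases i <;> simp [matB, actB, V5.vec, Matrix.mulVec, dotProduct, Fin.sum_univ_five] <;> ring

theorem acts_wordG {A B : G5} (hA : (A : M5) = matA) (hB : (B : M5) = matB) (w : List ℤ) (t : Bool) :
    Acts (wordG A B w t : M5) (actW w t) := by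
  have kA : Acts (A : M5) actA := by rw [hA]; exact acts_matA
  have kB : Acts (B : M5) actB := by rw [hB]; exact acts_matB
  induction w generalizing t with
  | nil => exact acts_oneG
  | cons k ks ih =>
    cases t
    · exact (acts_mul (acts_powAct (g := actBi) kB (by intro v; ext <;> simp [actB, actBi]) k)
        (ih true)).congr (fun v => rfl)
    · exact (acts_mul (acts_powAct (g := actAi) kA (by intro v; ext <;> simp [actA, actAi]) k)
        (ih false)).congr (fun v => rfl)

theorem wordG_mem {A B : G5} {Γ : Subgroup G5} (hA : A ∈ Γ) (hB : B ∈ Γ) (w : List ℤ) (t : Bool) :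
    wordG A B w t ∈ Γ := by
  induction w generalizing t with
  | nil => exact Γ.one_mem
  | cons k ks ih =>
    cases t
    · exact Γ.mul_mem (Γ.zpow_mem hB k) (ih true)
    · exact Γ.mul_mem (Γ.zpow_mem hA k) (ih false)

/-! ### The change of coordinates -/

/-- The columns form a basis (over `ℚ`) in which the quadratic form is split. -/
def Cm : M5 :=
  !![2, -9, 0, -2, -6; -4, -9, 12, 6, 3; 4, -6, -12, -8, -6; -2, -9, 12, 6, 6; 0, -3, 0, -2, 3]

def actC (v : V5) : V5 :=
  ⟨2 * v.x1 - 9 * v.x2 - 2 * v.y2 - 6 * v.y1,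
    -4 * v.x1 - 9 * v.x2 + 12 * v.w + 6 * v.y2 + 3 * v.y1,
    4 * v.x1 - 6 * v.x2 - 12 * v.w - 8 * v.y2 - 6 * v.y1,
    -2 * v.x1 - 9 * v.x2 + 12 * v.w + 6 * v.y2 + 6 * v.y1,
    -3 * v.x2 - 2 * v.y2 + 3 * v.y1⟩

theorem acts_Cm : Acts Cm actC := by
  intro v; ext i
  fin_cases i <;> simp [Cm, actC, V5.vec, Matrix.mulVec, dotProduct, Fin.sum_univ_five] <;> ring

/-- The group `Γ` seen in the new coordinates. -/
def Gpp (Γ : Subgroup G5) : Subgroup G5 where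
  carrier := {h | ∃ γ ∈ Γ, (γ : M5) * Cm = Cm * (h : M5)}
  one_mem' := ⟨1, Γ.one_mem, by simp⟩
  mul_mem' := by
    rintro h h' ⟨γ, hγ, e⟩ ⟨γ', hγ', e'⟩
    refine ⟨γ * γ', Γ.mul_mem hγ hγ', ?_⟩
    rw [Units.val_mul, Units.val_mul, mul_assoc, e', ← mul_assoc, e, mul_assoc]
  inv_mem' := by
    rintro h ⟨γ, hγ, e⟩
    refine ⟨γ⁻¹, Γ.inv_mem hγ, ?_⟩
    rw [Units.inv_mul_eq_iff_eq_mul, ← mul_assoc, e, mul_assoc, Units.mul_inv, mul_one]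

/-- The standing hypothesis on `Γ`. -/
structure HasAB (Γ : Subgroup G5) : Prop where
  ex : ∃ A ∈ Γ, ∃ B ∈ Γ, (A : M5) = matA ∧ (B : M5) = matB

theorem cert {Γ : Subgroup G5} (H : HasAB Γ) (w : List ℤ) {h : G5} {f : V5 → V5}
    (hf : Acts (h : M5) f) (hw : ∀ j, actW w true (actC (eb j)) = actC (f (eb j))) :
    h ∈ Gpp Γ := by
  obtain ⟨A, hA, B, hB, eA, eB⟩ := H.ex
  exact ⟨wordG A B w true, wordG_mem hA hB w true,
    ((acts_wordG eA eB w true).mul acts_Cm).ext_basis (acts_Cm.mul hf) hw⟩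

def baseOK (fL : ℤ → ℤ → ℤ → ℤ → V5 → V5) (fu : ℤ → ℤ → ℤ → V5 → V5)
    (L : List (List ℤ × M2 × ℤ × ℤ × ℤ)) : Bool :=
  L.all fun p => p.2.1.det == 1 && decide (∀ j, actW p.1 true (actC (eb j)) =
    actC (fL p.2.1.a p.2.1.b p.2.1.c p.2.1.d (fu p.2.2.1 p.2.2.2.1 p.2.2.2.2 (eb j))))

theorem baseOK_mem {Γ : Subgroup G5} (H : HasAB Γ) {φ : SL2 →* G5} {u : ℤ → ℤ → ℤ → G5} {κ : ℤ}
    (hp : Par φ u κ) {fL : ℤ → ℤ → ℤ → ℤ → V5 → V5} {fu : ℤ → ℤ → ℤ → V5 → V5}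
    (hL : ∀ g, Acts (φ g : M5) (fL (g 0 0) (g 0 1) (g 1 0) (g 1 1)))
    (hu : ∀ a b c, Acts (u a b c : M5) (fu a b c))
    {L : List (List ℤ × M2 × ℤ × ℤ × ℤ)} (h : baseOK fL fu L = true) :
    ∀ m ∈ L.map (fun p => p.2.1), InP (hp.P (Gpp Γ)) m := by
  intro m hm
  obtain ⟨⟨w, l, a, b, c⟩, hp', rfl⟩ := List.mem_map.mp hm
  simp only [baseOK, List.all_eq_true, Bool.and_eq_true, beq_iff_eq, decide_eq_true_eq] at h
  obtain ⟨hd, hw⟩ := h _ hp'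
  refine ⟨hd, a, b, c, ?_⟩
  have := hL l.sl
  rw [M2.sl_val hd] at this
  exact cert H w (acts_mul this (hu a b c)) hw

def baseL2 : List (List ℤ × M2 × ℤ × ℤ × ℤ) :=
  [([2, -4, -1, -4, -1, -4], ⟨-7, -8, 36, 41⟩, -459, -522, 594),
   ([2, -1, -7, -1, 4, 2, -1, -4], ⟨-17, -20, 6, 7⟩, 4608, 5424, -6384),
   ([-2, -1, -2, 5, 1, 3, 2, 1, -1, -2, -1, -5, 2, 1, -1], ⟨-1, -84, 6, 503⟩, 9, 1038, -87186),
   ([-2, -1, -1, 1, 5, 1, 1, -2, -2, -1, 1, 1, -1, -1, -5, -1, 1, 1, -1], ⟨1, -188, -6, 1129⟩, 9, -2562, -481662),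
   ([-1, -3, -1, -4, -1, 1, 2, -2, -2, -1, 1, 1, -2, -1, 1, 4, 1, 3, -2], ⟨1, 0, 264, 1⟩, 90738, 336, 0),
   ([0, 1, 6, -5, -1, -3, -1, 2, -6, -1, 5, 1, -1, -3], ⟨-19, -20, 210, 221⟩, -40257, -42366, 44586),
   ([-1, -1, -5, -1, -2, 4, 1, 3, 1, -2, 6, 1, -5, -1, 1, 3, -2], ⟨-101, -20, 6762, 1339⟩, 613719, 121530, -24066),
   ([-2, -1, -1, -6, -2, 1, 1, -5, -1, -5, 1, 5, 2, 6, 1, 1, -1], ⟨-7, -4, 30, 17⟩, 486, 276, -156),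
   ([-2, -5, -2, -6, -1, -4, -2, -1, 1, 3, 1, 6, 2, 5, -1], ⟨-1511, -420, 3630, 1009⟩, 10406457, 2892594, -804030),
   ([-2, 5, 2, -5, -1, -1, -2, -2, -1, 6, -1, -4, -1, -4, 5, 1, -1], ⟨3377, -172, -12114, 617⟩, 97694037, -4975830, -253434),
   ([-1, -4, -1, 2, 1, -5, -1, -4, -1, 2, -2, -1, 1, 1, -1, -4, -1, -4, -6, -1], ⟨-895, -44, 834, 41⟩, -39960, -1968, 96),
   ([-1, -1, -2, 5, 1, 3, 1, -1, -3, 2, 2, 1, -1, -1, 3, 1, -1, -3, -1, -5, 2, 1, -2], ⟨-11111, -4040, 36108, 13129⟩, 1331105400, 483994764, -175982256),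
   ([-2, 5, 2, -5, -1, -6, -2, 6, -1, -3, 1, 4, 8, 1, -1], ⟨233, -84, -846, 305⟩, 471267, -169902, -61254),
   ([-3, 4, 1, -2, -1, 5, 1, 4, 1, -2, 2, 1, -1, -1, 1, 4, 1, 4, 6, 1, -2], ⟨631, -44, -3198, 223⟩, 3691962, -257448, -17952),
   ([1, -5, -3, 1, 9, -1, -1, 1, 4, 1, -1, -1, 9, 1, -3, -5, -1], ⟨-14321, -6160, 52632, 22639⟩, -964007415, -414655794, 178359030),
   ([-1, -4, -7, 1, 6, 4, 1, -3, 1, 4, 1, 2, 1, 2, 2, 1, 7, 1, -1], ⟨1801, -696, -2052, 793⟩, 637740, -246456, -95244),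
   ([1, 4, 1, -1, -4, 1, 1, -1, -1, 4, 1, -2, -1, -4, -1, -1, -6, -1, -3, -1, 5, 1, -1, -3], ⟨-103081, -105396, 252426, 258095⟩, -6544869426, -6691854540, 6842140656),
   ([2, -4, -1, 1, 2, -5, -1, 1, 1, -2, -1, 1, 4, 1, -1, -1, -6, -1, -3, -1, 5, 1, -1, -3], ⟨-20077, -20528, 103056, 105371⟩, -3786842043, -3871907826, 3958884486),
   ([1, -1, -6, -4, -1, -4, -1, -4, -1, 1, 1, -6, -1, -6, 1, 1, -1, -4, -6, -1], ⟨1, 0, 36, 1⟩, -1350, -36, 0),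
   ([1, -1, -8, -4, -1, -1, -1, 1, 3, -1, -3, -1, 3, 3, -1, -3, -14, -1, -1], ⟨58651, 4748, 162402, 13147⟩, -16698889818, -1351832520, 109435488)]

def progL2 : List (ℕ × Bool × ℕ × Bool) :=
  [(17, true, 16, false), (4, true, 6, true), (18, true, 6, true), (18, false, 21, true),
   (18, false, 23, true), (18, false, 24, true), (18, false, 25, true), (18, false, 26, true),
   (18, true, 22, true), (27, true, 28, false), (0, false, 20, true), (19, true, 29, false),
   (0, false, 13, true), (28, true, 0, true), (32, true, 29, true), (9, true, 29, true),
   (10, true, 29, false), (29, true, 5, true), (16, true, 37, false), (18, true, 29, false),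
   (39, true, 29, false), (30, true, 38, true), (31, true, 1, true), (37, true, 36, true),
   (3, true, 42, false), (43, true, 40, false), (0, true, 1, false), (46, false, 2, true),
   (42, true, 47, true), (44, true, 48, true), (49, true, 42, false), (50, true, 48, true),
   (51, true, 42, false), (52, true, 48, true), (46, false, 53, true), (42, true, 54, true),
   (52, true, 55, true), (46, false, 56, true), (42, true, 57, true), (52, true, 58, true),
   (59, true, 57, true), (12, true, 58, true), (35, true, 40, true), (62, true, 7, true),
   (8, true, 63, true), (34, false, 15, true), (37, true, 1, false), (61, false, 63, true),
   (67, false, 57, true), (64, true, 68, true), (33, true, 34, true), (40, true, 60, true),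
   (71, false, 70, true), (30, true, 69, true), (73, true, 61, false), (74, true, 60, true),
   (67, true, 75, false), (69, true, 76, true), (75, false, 41, true), (78, true, 75, true),
   (75, true, 34, true), (61, true, 76, true), (1, true, 79, true), (82, true, 1, false),
   (83, true, 66, false), (14, true, 77, true), (85, true, 1, false), (86, true, 66, false),
   (72, true, 80, false), (81, false, 87, true), (1, false, 89, true), (75, true, 90, true),
   (76, true, 88, true), (92, true, 66, true), (93, true, 84, true), (92, true, 45, true),
   (80, true, 65, true), (58, true, 76, true), (97, true, 60, false), (11, true, 98, false),
   (99, true, 71, true), (100, true, 60, false), (101, true, 71, true), (102, true, 60, false),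
   (103, true, 71, true), (104, true, 60, false), (105, true, 71, true), (106, true, 60, false),
   (107, true, 71, true), (108, true, 60, false), (109, true, 71, true), (110, true, 60, false),
   (111, true, 71, true), (112, true, 60, false), (113, true, 71, true), (114, true, 60, false),
   (115, true, 71, true), (116, true, 60, false), (117, true, 71, true), (118, true, 60, false),
   (119, true, 71, true), (120, true, 60, false), (121, true, 71, true), (122, true, 60, false),
   (123, true, 71, true), (124, true, 60, false), (125, true, 71, true), (126, true, 60, false),
   (127, true, 71, true), (128, true, 60, false), (129, true, 71, true), (130, true, 60, false),
   (131, true, 71, true), (132, true, 60, false), (133, true, 71, true), (134, true, 60, false),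
   (135, true, 71, true), (136, true, 60, false), (137, true, 71, true), (138, true, 60, false),
   (139, true, 71, true), (140, true, 60, false), (96, true, 98, true), (142, true, 77, true),
   (143, true, 77, true), (144, false, 91, true), (71, true, 76, false), (146, true, 94, true),
   (60, true, 84, true), (7, false, 148, true), (81, false, 141, true), (150, true, 95, false),
   (60, true, 76, false), (80, true, 98, true), (153, true, 77, true), (60, false, 7, true),
   (155, true, 149, true), (156, true, 147, false), (157, true, 146, true),
   (7, false, 60, true), (98, false, 80, false), (146, false, 147, true),
   (95, true, 141, false), (1, true, 145, true), (163, true, 92, false),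
   (146, false, 147, true), (165, true, 149, false), (166, true, 75, false)]

def repsL2 : List M2 :=
  [⟨1, 0, 0, 1⟩, ⟨1, 1, 0, 1⟩, ⟨1, -1, 0, 1⟩, ⟨0, -1, 1, 0⟩, ⟨1, 2, 0, 1⟩, ⟨1, -1, 1, 0⟩,
   ⟨1, -2, 0, 1⟩, ⟨-1, -1, 1, 0⟩, ⟨0, -1, 1, 1⟩, ⟨0, -1, 1, -1⟩, ⟨1, 3, 0, 1⟩, ⟨2, -1, 1, 0⟩,
   ⟨1, 0, 1, 1⟩, ⟨1, -2, 1, -1⟩, ⟨1, -3, 0, 1⟩, ⟨-2, -1, 1, 0⟩, ⟨-1, -2, 1, 1⟩, ⟨-1, 0, 1, -1⟩,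
   ⟨0, -1, 1, 2⟩, ⟨0, -1, 1, -2⟩, ⟨1, 4, 0, 1⟩, ⟨3, -1, 1, 0⟩, ⟨2, 1, 1, 1⟩, ⟨2, -3, 1, -1⟩,
   ⟨1, 1, 1, 2⟩, ⟨1, -3, 1, -2⟩, ⟨-3, -1, 1, 0⟩, ⟨-2, -3, 1, 1⟩, ⟨-2, 1, 1, -1⟩, ⟨-1, -3, 1, 2⟩,
   ⟨-1, 1, 1, -2⟩, ⟨0, -1, 1, 3⟩, ⟨-1, 0, 2, -1⟩, ⟨0, -1, 1, -3⟩, ⟨-1, 0, -2, -1⟩,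
   ⟨4, -1, 1, 0⟩, ⟨3, 2, 1, 1⟩, ⟨3, -4, 1, -1⟩, ⟨2, 3, 1, 2⟩, ⟨2, -5, 1, -2⟩, ⟨1, 2, 1, 3⟩,
   ⟨1, -1, 2, -1⟩, ⟨1, -4, 1, -3⟩, ⟨-3, -1, -2, -1⟩, ⟨-3, -4, 1, 1⟩, ⟨-3, 2, 1, -1⟩,
   ⟨-2, -5, 1, 2⟩, ⟨-2, 3, 1, -2⟩, ⟨-1, -4, 1, 3⟩, ⟨-3, 1, 2, -1⟩, ⟨1, 1, -2, -1⟩,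
   ⟨0, -1, 1, 4⟩, ⟨-1, 0, 3, -1⟩, ⟨-1, 1, 2, -3⟩, ⟨0, -1, 1, -4⟩, ⟨-1, 0, -3, -1⟩,
   ⟨-1, -1, -2, -3⟩, ⟨4, 3, 1, 1⟩, ⟨4, -5, 1, -1⟩, ⟨3, 5, 1, 2⟩, ⟨3, -7, 1, -2⟩, ⟨2, 5, 1, 3⟩,
   ⟨3, -2, 2, -1⟩, ⟨2, -7, 1, -3⟩, ⟨-5, -2, -2, -1⟩, ⟨2, -1, 3, -1⟩, ⟨1, -2, 2, -3⟩,
   ⟨-4, -1, -3, -1⟩, ⟨-3, -4, -2, -3⟩, ⟨-3, -7, 1, 2⟩, ⟨-3, 5, 1, -2⟩, ⟨-5, 2, 2, -1⟩,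
   ⟨3, 2, -2, -1⟩, ⟨-4, 1, 3, -1⟩, ⟨1, 2, -2, -3⟩, ⟨-1, 0, 4, -1⟩, ⟨-1, -1, 3, 2⟩,
   ⟨-1, 1, 3, -4⟩, ⟨-1, 0, -4, -1⟩, ⟨-1, -1, -3, -4⟩, ⟨-1, 1, -3, 2⟩, ⟨5, -3, 2, -1⟩,
   ⟨3, -10, 1, -3⟩, ⟨-7, -3, -2, -1⟩, ⟨5, -2, 3, -1⟩, ⟨-7, -2, -3, -1⟩, ⟨-5, -7, -2, -3⟩,
   ⟨2, 1, 3, 2⟩, ⟨2, -3, 3, -4⟩, ⟨-4, -5, -3, -4⟩, ⟨-4, 3, -3, 2⟩, ⟨-7, 3, 2, -1⟩,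
   ⟨5, 3, -2, -1⟩, ⟨-5, 7, 2, -3⟩, ⟨5, -8, 2, -3⟩, ⟨-10, -3, -3, -1⟩]

def tgtL2 : List (ℕ × ℕ) :=
  [(3, 1), (5, 4), (7, 0), (0, 8), (11, 10), (1, 12), (15, 2), (2, 16), (17, 18), (12, 3),
   (21, 20), (4, 22), (9, 24), (22, 5), (26, 6), (6, 27), (28, 29), (8, 7), (32, 31), (34, 9),
   (35, 14), (10, 36), (13, 38), (36, 11), (41, 40), (43, 13), (14, 44), (45, 46), (16, 15),
   (49, 48), (50, 17), (52, 51), (18, 50), (55, 19), (19, 56), (20, 57), (23, 59), (57, 21),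
   (62, 61), (64, 23), (65, 30), (24, 34), (67, 25), (25, 68), (58, 69), (27, 26), (71, 63),
   (72, 28), (73, 70), (29, 72), (30, 74), (75, 58), (31, 76), (76, 32), (78, 33), (33, 79),
   (80, 62), (37, 54), (44, 35), (81, 42), (83, 37), (84, 47), (38, 43), (85, 39), (39, 86),
   (40, 87), (87, 41), (42, 89), (90, 49), (91, 82), (92, 45), (46, 92), (47, 53), (48, 90),
   (88, 91), (51, 93), (53, 84), (93, 52), (54, 83), (86, 85), (56, 55), (59, 64), (95, 60),
   (60, 66), (61, 80), (63, 77), (79, 78), (66, 95), (74, 65), (94, 73), (68, 67), (69, 75),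
   (70, 94), (77, 71), (89, 81), (82, 88)]

def baseS1 : List (List ℤ × M2 × ℤ × ℤ × ℤ) :=
  [([-6], ⟨1, 18, 0, 1⟩, 0, 0, 0), ([-1, 2, -6, -2, 1], ⟨25, 72, -8, -23⟩, 0, 0, 0),
   ([-1, 2, -2, 1, 2, -5, -1, -2], ⟨127, 45, -48, -17⟩, 0, 4, 0),
   ([-1, 2, -1, -2, -1, -5, 2, 1, -1], ⟨43, -144, -20, 67⟩, 54, 16, 864),
   ([0, -1, -1, 3, 1, 5, -2, -1, 2], ⟨-47, -369, 20, 157⟩, -594, 76, -44940),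
   ([0, -1, -1, 1, 1, -1, -2, 5, 1, 2, 1], ⟨-89, -369, 48, 199⟩, -612, 148, -90336),
   ([-1, 2, 1, -1, -2, 5, 1, 2, 1, -1, 1, 1], ⟨-97, 45, 28, -13⟩, 12, 24, 306),
   ([-3, 1, 8, 5, -1, -4], ⟨-89, -423, 4, 19⟩, -108, 24, -2454),
   ([0, -1, -1, 1, 2, -1, -8, -4, -1, -5], ⟨193, 423, -120, -263⟩, 738, -336, -248502),
   ([0, 5, 1, 1, 1, -7, 5, 3, 1, 4, 1], ⟨113, -369, -64, 209⟩, -294, -88, 26466),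
   ([0, -1, -1, 4, 1, -4, -1, 1, 5, 5, -1, -4, 1, 1], ⟨-1091, -3042, 392, 1093⟩, -5148, 1848, -9504792),
   ([-1, 6, 1, -2, -1, 7, -5, -3, -1, -4], ⟨-175, -1359, 64, 497⟩, -798, 104, -82002),
   ([0, -1, -1, 5, 1, 3, 4, 1, -1, -6, 1, 2, -1, -4], ⟨-37, -369, 36, 359⟩, 12, 0, -18),
   ([0, -1, -1, 5, 1, -2, -1, 7, -5, -3, -1, -6, 1], ⟨259, 684, -220, -581⟩, 234, -88, -20736),
   ([-1, 5, 1, -5, -1, 1, 1, 5, 3, 5, 2, 6, 1, 3, 1], ⟨-2893, -9549, 276, 911⟩, -4884, 1480, -7226730),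
   ([0, -1, -1, 1, -1, -3, -1, -6, -2, -5, -3, -5, -1, -1, 1, 5, -1, -3], ⟨-1651, -1980, -276, -331⟩, -780, 652, -507306)]

def progS1 : List (ℕ × Bool × ℕ × Bool) :=
  [(0, true, 7, true), (13, true, 2, true), (11, true, 4, false), (5, true, 16, true),
   (15, true, 17, true), (0, true, 14, true), (12, true, 0, false), (8, true, 3, true),
   (10, true, 1, false), (21, true, 24, false), (25, true, 1, false), (26, true, 24, false),
   (27, true, 1, false), (28, true, 24, false), (29, true, 1, false), (30, true, 24, false),
   (31, true, 1, false), (32, true, 24, false), (33, true, 1, false), (34, true, 24, false),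
   (35, true, 1, false), (24, true, 36, false), (37, false, 18, true), (38, true, 4, true),
   (37, true, 20, true), (1, false, 40, true), (1, false, 41, true), (1, false, 42, true),
   (1, false, 43, true), (1, false, 44, true), (1, false, 45, true), (0, true, 39, false),
   (22, true, 47, true), (46, false, 6, true), (17, true, 46, false), (36, true, 50, false),
   (51, false, 47, true), (48, true, 52, false), (52, false, 9, true), (50, true, 1, true),
   (55, true, 37, true), (56, true, 51, true), (57, true, 23, true), (3, true, 58, false),
   (38, true, 58, true), (54, true, 60, false), (52, true, 61, true), (62, false, 19, true),
   (53, true, 62, true), (61, false, 39, true), (56, true, 65, true), (66, false, 50, true),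
   (67, false, 37, true), (66, false, 64, true), (59, false, 69, true), (38, true, 70, true),
   (61, false, 71, true), (63, true, 68, true), (57, true, 66, false), (60, true, 73, false),
   (67, false, 2, true), (46, false, 76, true), (59, true, 38, false), (67, true, 46, true),
   (79, true, 49, true), (38, true, 80, true), (75, false, 81, true), (77, true, 82, true),
   (83, true, 72, true), (82, false, 83, true), (82, false, 84, true), (79, true, 82, true),
   (87, false, 67, true), (88, false, 86, true), (16, false, 89, true), (68, false, 90, true),
   (73, true, 91, true), (75, true, 73, true), (16, true, 68, true), (88, false, 87, false),
   (68, false, 16, false), (96, true, 68, true), (78, false, 38, false)]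

def repsS1 : List M2 :=
  [⟨1, 0, 0, 1⟩, ⟨1, 1, 0, 1⟩, ⟨1, -1, 0, 1⟩, ⟨0, -1, 1, 0⟩, ⟨1, 2, 0, 1⟩, ⟨1, -1, 1, 0⟩,
   ⟨1, -2, 0, 1⟩, ⟨-1, -1, 1, 0⟩, ⟨0, -1, 1, 1⟩, ⟨0, -1, 1, -1⟩, ⟨1, 3, 0, 1⟩, ⟨2, -1, 1, 0⟩,
   ⟨1, 0, 1, 1⟩, ⟨1, -2, 1, -1⟩, ⟨1, -3, 0, 1⟩, ⟨-2, -1, 1, 0⟩, ⟨-1, -2, 1, 1⟩, ⟨-1, 0, 1, -1⟩,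
   ⟨0, -1, 1, 2⟩, ⟨1, 4, 0, 1⟩, ⟨3, -1, 1, 0⟩, ⟨2, 1, 1, 1⟩, ⟨2, -3, 1, -1⟩, ⟨1, 1, 1, 2⟩,
   ⟨1, -3, 1, -2⟩, ⟨1, -4, 0, 1⟩, ⟨-3, -1, 1, 0⟩, ⟨-2, -3, 1, 1⟩, ⟨-2, 1, 1, -1⟩,
   ⟨-1, -3, 1, 2⟩, ⟨-1, 1, 1, -2⟩, ⟨-1, 0, 2, -1⟩, ⟨4, -1, 1, 0⟩, ⟨3, 2, 1, 1⟩, ⟨3, -4, 1, -1⟩,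
   ⟨2, -5, 1, -2⟩, ⟨1, 2, 1, 3⟩, ⟨1, -1, 2, -1⟩, ⟨-3, -1, -2, -1⟩, ⟨-4, -1, 1, 0⟩,
   ⟨-3, -4, 1, 1⟩, ⟨-3, 2, 1, -1⟩, ⟨-2, -5, 1, 2⟩, ⟨-3, 1, 2, -1⟩, ⟨-1, 2, 1, -3⟩,
   ⟨1, 1, -2, -1⟩, ⟨4, 3, 1, 1⟩, ⟨4, -5, 1, -1⟩, ⟨3, 5, 1, 2⟩, ⟨2, -7, 1, -3⟩, ⟨-5, -2, -2, -1⟩,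
   ⟨1, 3, 1, 4⟩, ⟨2, -1, 3, -1⟩, ⟨1, -2, 2, -3⟩, ⟨-4, -5, 1, 1⟩, ⟨-4, 3, 1, -1⟩, ⟨-3, -7, 1, 2⟩,
   ⟨-2, -7, 1, 3⟩, ⟨-5, 2, 2, -1⟩, ⟨-1, 3, 1, -4⟩, ⟨2, 1, -3, -1⟩, ⟨1, 2, -2, -3⟩, ⟨4, 7, 1, 2⟩,
   ⟨4, -9, 1, -2⟩, ⟨5, -3, 2, -1⟩, ⟨2, -9, 1, -4⟩, ⟨3, -1, 4, -1⟩, ⟨2, 1, 3, 2⟩, ⟨1, -3, 2, -5⟩,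
   ⟨3, 1, -4, -1⟩, ⟨-9, -4, -2, -1⟩, ⟨-9, -2, -4, -1⟩]

def tgtS1 : List (ℕ × ℕ) :=
  [(3, 1), (5, 4), (7, 0), (0, 8), (11, 10), (1, 12), (15, 2), (2, 16), (17, 18), (12, 3),
   (20, 19), (4, 21), (9, 23), (21, 5), (26, 6), (6, 27), (28, 29), (8, 7), (31, 9), (32, 25),
   (10, 33), (13, 24), (33, 11), (37, 36), (38, 13), (39, 14), (14, 40), (41, 42), (16, 15),
   (43, 28), (45, 17), (18, 45), (19, 46), (22, 48), (46, 20), (50, 22), (52, 51), (23, 31),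
   (24, 38), (25, 54), (55, 56), (27, 26), (58, 57), (29, 43), (60, 30), (30, 61), (34, 62),
   (54, 32), (64, 34), (57, 35), (35, 58), (66, 52), (36, 67), (67, 37), (47, 63), (40, 39),
   (68, 41), (49, 65), (42, 68), (69, 44), (44, 59), (62, 64), (61, 60), (70, 47), (48, 50),
   (71, 49), (51, 66), (53, 55), (56, 53), (59, 69), (63, 70), (65, 71)]

def baseS2 : List (List ℤ × M2 × ℤ × ℤ × ℤ) :=
  [([1], ⟨1, -1, 1, 0⟩, 3, 0, 6), ([0, 1, 5, 1], ⟨1, 11, 1, 12⟩, 3, 0, 6),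
   ([0, -3, -1, -5, 2, 1, -1, -1], ⟨-97, 127, -55, 72⟩, -117, 90, 10455),
   ([0, -1, -1, 1, 2, -5, -1, -3], ⟨-55, 127, -13, 30⟩, -81, 36, 2841),
   ([0, 1, 2, -1, -8, -5, 1, 5], ⟨-83, -97, -77, -90⟩, 39, 36, -1299),
   ([0, -4, -1, 4, 1, -1, -5, -5, 1, 4], ⟨505, -588, 432, -503⟩, 504, -432, 218160),
   ([0, -5, -1, -3, -5, 7, -1, -2, 1, 5], ⟨54, 251, -17, -79⟩, -525, -111, -59298),
   ([0, -6, -1, -1, -1, 7, -5, -3, -1, -5], ⟨-330, 251, -401, 305⟩, -489, 645, 314382),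
   ([0, 4, 1, -5, -1, 1, 1, 5, 3, 5, 2, 6, 1, 4], ⟨-2479, 2976, -414, 497⟩, -2664, 2220, 5911695)]

def progS2 : List (ℕ × Bool × ℕ × Bool) :=
  [(0, false, 2, true), (7, true, 0, false), (9, true, 0, true), (11, true, 6, true),
   (0, true, 10, true), (8, true, 0, true), (3, true, 0, true), (0, false, 5, true),
   (16, true, 0, true), (0, true, 1, true), (17, true, 18, false), (0, false, 4, true),
   (18, true, 20, true), (0, true, 21, true), (15, true, 22, true), (22, true, 11, true),
   (0, false, 23, true), (13, true, 25, true), (19, true, 26, true), (27, true, 12, true),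
   (0, false, 14, true), (26, false, 29, true), (12, false, 30, true), (28, true, 31, true),
   (18, true, 32, true), (26, false, 33, true), (12, false, 34, true), (28, true, 35, true),
   (18, true, 36, true), (26, false, 37, true), (12, false, 38, true), (28, true, 39, true),
   (18, true, 40, true), (26, false, 41, true), (12, false, 42, true), (28, true, 43, true),
   (18, true, 44, true), (26, false, 45, true), (12, false, 46, true), (28, true, 47, true),
   (18, true, 48, true), (26, false, 49, true), (12, false, 50, true), (28, true, 51, true),
   (18, true, 52, true), (26, false, 53, true), (12, false, 54, true), (28, true, 55, true),
   (56, false, 55, true), (57, true, 56, true), (58, true, 57, false), (12, true, 57, false),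
   (24, true, 57, false), (57, false, 25, true), (59, true, 57, true), (22, false, 59, false),
   (59, true, 22, true), (65, true, 60, true), (66, true, 57, false), (67, true, 59, false),
   (59, true, 61, true), (69, true, 59, false), (60, false, 62, false), (59, true, 61, false),
   (72, true, 22, true), (73, true, 60, true), (74, true, 57, false), (75, true, 59, false)]

def repsS2 : List M2 :=
  [⟨1, 0, 0, 1⟩, ⟨1, 1, 0, 1⟩, ⟨1, -1, 0, 1⟩, ⟨1, 2, 0, 1⟩, ⟨1, -2, 0, 1⟩, ⟨-1, -1, 1, 0⟩,
   ⟨1, 3, 0, 1⟩, ⟨2, -1, 1, 0⟩, ⟨-2, -1, 1, 0⟩, ⟨-1, -2, 1, 1⟩, ⟨3, -1, 1, 0⟩, ⟨2, -3, 1, -1⟩,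
   ⟨-2, -3, 1, 1⟩, ⟨-2, 1, 1, -1⟩, ⟨-1, -3, 1, 2⟩, ⟨3, 2, 1, 1⟩, ⟨3, -4, 1, -1⟩, ⟨2, -5, 1, -2⟩,
   ⟨-2, -5, 1, 2⟩, ⟨-2, 3, 1, -2⟩, ⟨3, 5, 1, 2⟩, ⟨3, -7, 1, -2⟩, ⟨-2, -7, 1, 3⟩, ⟨3, 8, 1, 3⟩]

def tgtS2 : List (ℕ × ℕ) :=
  [(1, 1), (0, 3), (5, 0), (7, 6), (8, 2), (2, 9), (10, 4), (3, 5), (4, 12), (13, 14), (6, 15),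
   (15, 7), (16, 18), (9, 8), (18, 17), (11, 20), (12, 10), (21, 11), (14, 22), (22, 13),
   (23, 23), (17, 16), (19, 19), (20, 21)]

def baseL1 : List (List ℤ × M2 × ℤ × ℤ × ℤ) :=
  [([-1, 4, 1, 4, 1, 4, -1], ⟨17, -36, -8, 17⟩, -1431, -672, -318),
   ([1, -6, -2, -5, -1, -5], ⟨5, 6, 4, 5⟩, 126, -102, 84),
   ([-1, 4, 1, -2, -3, -1, 8, 1, -1], ⟨-43, -114, 20, 53⟩, -13824, 5214, -1968),
   ([-3, -1, -2, 5, 1, 3, 2, 1, -1, -2, -1, -5, 2, 1], ⟨251, 750, 84, 251⟩, 2659455, -890022, 297858),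
   ([-3, -1, -1, 1, 5, 1, 1, -2, -2, -1, 1, 1, -1, -1, -5, -1, 1, 1], ⟨565, 1698, 188, 565⟩, 13947435, -4640922, 1544238),
   ([-2, -3, -1, -4, -1, 1, 2, -2, -2, -1, 1, 1, -2, -1, 1, 4, 1, 3, -1], ⟨1, -264, 0, 1⟩, 156834, 600, 0),
   ([-1, 1, 6, -5, -1, -3, -1, 2, -6, -1, 5, 1, -1, -3, 1], ⟨161, 330, 20, 41⟩, 7785, -3798, 1854),
   ([1, -1, -6, 5, 1, 3, 1, -2, 6, 1, -5, -1, 1, 3, -1], ⟨161, -330, -20, 41⟩, 103635, 50562, 24666),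
   ([-3, -5, -2, -6, -1, -4, -2, -1, 1, 3, 1, 6, 2, 5], ⟨251, -150, -420, 251⟩, 272763, 456414, 763710),
   ([-1, 1, 6, -5, -1, -4, -4, -1, 12, 1, -1, -4, 1], ⟨415, 822, 52, 103⟩, 47241, -23850, 12042),
   ([-3, 5, 2, -5, -1, -1, -2, -3, 1, 5, -1, -4, -1, -4, 5, 1], ⟨101, 2286, 172, 3893⟩, 233918451, -10334958, 456618),
   ([0, -5, -2, -1, -5, 1, 3, 2, 1, -2, 1, 2, -1, -3, 5, 1, -8, -1], ⟨-10303, 58716, -15408, 87809⟩, 21460212684, 3765661344, 660767232),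
   ([0, -1, -8, -4, -1, 3, 1, 6, 1, 1, 1, 1, -1, -4, 1, 5, -2, -5], ⟨-6785, -4056, 1176, 703⟩, -1574118, 2633232, -4404948),
   ([0, -5, -3, 1, 9, -1, -1, 1, 4, 1, -1, -1, 9, 1, -3, -5], ⟨4159, 2808, 6160, 4159⟩, 48543615, -71899176, 106491690),
   ([-2, -4, -1, 2, 1, -5, -1, -4, -1, 2, -2, -1, 1, 1, -1, -4, -1, -4, -6, -1, 1], ⟨91, -1578, -44, 763⟩, -3016512, -173958, -10032),
   ([1, -4, -1, 2, 1, -5, -1, -4, -1, 1, 1, -1, -1, -1, 1, 1, -1, -4, -1, -4, -6, -1, -2], ⟨91, 1578, 44, 763⟩, 6192144, -357078, 20592),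
   ([-2, -4, -7, 1, 6, 5, -1, -2, 1, 4, 1, 2, 1, 2, 2, 1, 7, 1], ⟨-1295, -7236, 696, 3889⟩, -68138496, 12194496, -2182404),
   ([0, -1, -8, -4, -1, -1, -1, 1, 3, -1, -3, -1, 3, 3, -1, -3, -14, -1], ⟨27391, -256182, -4748, 44407⟩, -6285296466, -672024402, -71852904),
   ([-1, 3, 1, -1, -5, 1, 3, 1, 6, 1, 1, 4, 1, 2, -1, -4, 1, 1, -1, -1, 4, 1, -1, -4], ⟨-213107, -117462, 105396, 58093⟩, -15379425630, 27902328054, -50622170784),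
   ([-1, 4, 1, -1, -2, -6, -2, 2, 1, -1, -4, -1, 1, 1, 6, 1, 3, 1, -5, -1, 1, 3, -1], ⟨43787, -88536, -20528, 41507⟩, -8448073623, -4178139960, -2066370906),
   ([-1, 1, 6, 4, 1, -1, -1, 6, 1, 6, -1, -1, 1, 4, 1, 4, 1, 4, 6, 1], ⟨1, 36, 0, 1⟩, 54, 0, 0)]

def progL1 : List (ℕ × Bool × ℕ × Bool) :=
  [(5, true, 20, true), (21, true, 20, true), (22, true, 20, true), (23, true, 20, true),
   (24, true, 20, true), (25, true, 20, true), (26, true, 20, true), (12, true, 8, true),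
   (19, true, 7, false), (6, true, 18, true), (14, true, 27, false), (15, true, 27, true),
   (10, true, 27, true), (20, true, 27, true), (34, true, 27, true), (0, true, 32, true),
   (33, true, 35, false), (7, true, 0, false), (0, false, 31, true), (6, true, 0, true),
   (28, false, 17, true), (41, true, 35, true), (42, true, 2, false), (4, true, 43, false),
   (44, true, 8, false), (0, false, 29, true), (9, false, 30, true), (35, false, 40, true),
   (0, false, 2, true), (38, true, 47, true), (35, true, 38, true), (9, true, 51, false),
   (35, false, 52, true), (49, false, 3, true), (43, true, 54, true), (8, true, 55, true),
   (45, true, 56, true), (57, true, 43, false), (58, true, 8, false), (59, true, 56, true),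
   (60, true, 43, false), (8, true, 61, false), (62, true, 49, true), (43, true, 63, false),
   (64, true, 56, true), (61, true, 65, true), (49, false, 66, true), (63, true, 67, true),
   (64, true, 68, true), (63, true, 69, false), (50, true, 70, true), (46, true, 71, true),
   (35, true, 71, true), (73, false, 72, true), (68, true, 49, false), (49, false, 74, true),
   (0, false, 76, true), (48, true, 77, true), (73, true, 78, false), (53, true, 79, true),
   (79, true, 80, true), (81, true, 48, true), (82, false, 79, true), (0, true, 83, true),
   (78, true, 49, true), (85, true, 0, true), (84, true, 86, true), (82, true, 39, true),
   (84, false, 36, true), (84, false, 16, true), (37, true, 1, true), (91, true, 84, true),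
   (70, true, 92, true), (93, false, 75, true), (69, true, 94, true), (28, true, 95, true),
   (90, true, 96, true), (97, true, 93, true), (89, true, 96, true), (99, false, 98, true),
   (81, true, 99, true), (93, true, 0, true), (13, true, 102, true), (102, true, 95, false),
   (104, true, 103, true), (93, false, 105, true), (104, true, 11, true),
   (93, false, 107, true), (106, true, 82, false), (84, false, 109, true),
   (99, false, 110, true), (100, false, 111, true), (112, true, 101, true),
   (84, false, 108, true), (99, false, 114, true), (101, true, 115, true),
   (82, false, 116, true), (95, true, 117, true), (104, true, 118, true),
   (93, false, 119, true), (84, false, 120, true), (99, false, 121, true),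
   (101, true, 122, true), (82, false, 123, true), (95, true, 124, true),
   (104, true, 125, true), (93, false, 126, true), (35, true, 96, true), (127, true, 128, true),
   (88, true, 128, true), (104, false, 113, true), (101, true, 131, false),
   (132, false, 130, true), (1, true, 129, true), (87, true, 134, true), (1, true, 135, true),
   (87, true, 136, true), (1, true, 137, true), (133, true, 138, false), (132, true, 139, true),
   (128, true, 138, false), (131, true, 100, true), (138, false, 141, false),
   (141, true, 138, true), (144, true, 96, false), (1, true, 87, true), (93, false, 104, true),
   (147, true, 95, true), (94, false, 99, true), (139, true, 140, false),
   (100, false, 99, false), (82, true, 87, false), (152, true, 84, true),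
   (95, false, 104, false), (140, true, 139, false), (155, true, 142, true),
   (156, true, 100, false), (157, true, 99, false)]

def repsL1 : List M2 :=
  [⟨1, 0, 0, 1⟩, ⟨1, 1, 0, 1⟩, ⟨1, -1, 0, 1⟩, ⟨0, -1, 1, 0⟩, ⟨1, 2, 0, 1⟩, ⟨1, -1, 1, 0⟩,
   ⟨1, -2, 0, 1⟩, ⟨-1, -1, 1, 0⟩, ⟨0, -1, 1, 1⟩, ⟨0, -1, 1, -1⟩, ⟨1, 3, 0, 1⟩, ⟨2, -1, 1, 0⟩,
   ⟨1, 0, 1, 1⟩, ⟨1, -2, 1, -1⟩, ⟨1, -3, 0, 1⟩, ⟨-2, -1, 1, 0⟩, ⟨-1, -2, 1, 1⟩, ⟨-1, 0, 1, -1⟩,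
   ⟨0, -1, 1, 2⟩, ⟨0, -1, 1, -2⟩, ⟨1, 4, 0, 1⟩, ⟨3, -1, 1, 0⟩, ⟨2, 1, 1, 1⟩, ⟨2, -3, 1, -1⟩,
   ⟨1, 1, 1, 2⟩, ⟨1, -3, 1, -2⟩, ⟨1, -4, 0, 1⟩, ⟨-3, -1, 1, 0⟩, ⟨-2, -3, 1, 1⟩, ⟨-2, 1, 1, -1⟩,
   ⟨-1, 1, 1, -2⟩, ⟨0, -1, 1, 3⟩, ⟨-1, 0, 2, -1⟩, ⟨0, -1, 1, -3⟩, ⟨-1, 0, -2, -1⟩, ⟨1, 5, 0, 1⟩,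
   ⟨4, -1, 1, 0⟩, ⟨3, 2, 1, 1⟩, ⟨3, -4, 1, -1⟩, ⟨2, 3, 1, 2⟩, ⟨2, -5, 1, -2⟩, ⟨1, 2, 1, 3⟩,
   ⟨1, -1, 2, -1⟩, ⟨-3, -1, -2, -1⟩, ⟨1, -5, 0, 1⟩, ⟨-4, -1, 1, 0⟩, ⟨-3, -4, 1, 1⟩,
   ⟨-3, 2, 1, -1⟩, ⟨-2, -5, 1, 2⟩, ⟨-2, 3, 1, -2⟩, ⟨-1, 2, 1, -3⟩, ⟨1, 1, -2, -1⟩,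
   ⟨0, -1, 1, 4⟩, ⟨-1, 0, 3, -1⟩, ⟨-1, 1, 2, -3⟩, ⟨-1, 0, -3, -1⟩, ⟨-1, -1, -2, -3⟩,
   ⟨1, 6, 0, 1⟩, ⟨5, -1, 1, 0⟩, ⟨4, 3, 1, 1⟩, ⟨4, -5, 1, -1⟩, ⟨3, 5, 1, 2⟩, ⟨3, -7, 1, -2⟩,
   ⟨3, -2, 2, -1⟩, ⟨2, -7, 1, -3⟩, ⟨-5, -2, -2, -1⟩, ⟨1, 3, 1, 4⟩, ⟨-3, -4, -2, -3⟩,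
   ⟨-5, -1, 1, 0⟩, ⟨-4, -5, 1, 1⟩, ⟨-4, 3, 1, -1⟩, ⟨-2, -7, 1, 3⟩, ⟨-5, 2, 2, -1⟩,
   ⟨-1, 3, 1, -4⟩, ⟨-1, -1, 3, 2⟩, ⟨-1, 2, 2, -5⟩, ⟨-1, 1, -3, 2⟩, ⟨-1, -2, -2, -5⟩,
   ⟨5, 4, 1, 1⟩, ⟨4, 7, 1, 2⟩, ⟨5, -3, 2, -1⟩, ⟨-7, -3, -2, -1⟩, ⟨3, -5, 2, -3⟩, ⟨2, -9, 1, -4⟩,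
   ⟨1, 4, 1, 5⟩, ⟨3, -1, 4, -1⟩, ⟨-5, 4, 1, -1⟩, ⟨-4, 7, 1, -2⟩, ⟨-1, 4, 1, -5⟩, ⟨3, 1, -4, -1⟩,
   ⟨5, 9, 1, 2⟩, ⟨4, 11, 1, 3⟩, ⟨-9, -2, -4, -1⟩, ⟨3, -4, 4, -5⟩, ⟨-4, 11, 1, -3⟩,
   ⟨4, 15, 1, 4⟩]

def tgtL1 : List (ℕ × ℕ) :=
  [(3, 1), (5, 4), (7, 0), (0, 8), (11, 10), (1, 12), (15, 2), (2, 16), (17, 18), (12, 3),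
   (21, 20), (4, 22), (9, 24), (22, 5), (27, 6), (6, 28), (29, 25), (8, 7), (32, 31), (34, 9),
   (36, 35), (10, 37), (13, 39), (37, 11), (42, 41), (43, 13), (45, 14), (14, 46), (47, 48),
   (16, 15), (51, 17), (53, 52), (18, 51), (55, 19), (19, 56), (58, 57), (20, 59), (23, 61),
   (59, 21), (63, 60), (65, 23), (64, 66), (24, 34), (25, 67), (68, 26), (26, 69), (70, 62),
   (28, 27), (72, 71), (67, 29), (71, 30), (30, 72), (57, 33), (31, 74), (74, 32), (33, 58),
   (76, 77), (52, 44), (35, 78), (38, 79), (78, 36), (80, 47), (81, 38), (39, 43), (41, 40),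
   (40, 42), (85, 84), (49, 82), (44, 53), (86, 49), (46, 45), (50, 83), (48, 80), (89, 50),
   (54, 88), (87, 54), (56, 55), (79, 81), (60, 90), (77, 91), (61, 65), (62, 75), (90, 63),
   (92, 64), (91, 76), (66, 92), (69, 68), (75, 70), (94, 73), (73, 93), (82, 86), (84, 95),
   (83, 89), (95, 85), (88, 87), (93, 94)]


def fuL2 (a b c : ℤ) (v : V5) : V5 := aS1 1 a 0 1 (aL1 1 b 0 1 (aS2 1 c 0 1 v))
def fuS1 (a b c : ℤ) (v : V5) : V5 := aL1 1 a 0 1 (aL2 1 b 0 1 (aS2 1 c 0 1 v))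
def fuS2 (a b c : ℤ) (v : V5) : V5 := aL1 1 a 0 1 (aL2 1 0 b 1 (aS1 1 c 0 1 v))
def fuL1 (a b c : ℤ) (v : V5) : V5 := aS1 1 a 0 1 (aL2 1 0 b 1 (aS2 1 0 c 1 v))

theorem okL2 : baseOK aL2 fuL2 baseL2 = true := by decide +kernel
theorem okS1 : baseOK aS1 fuS1 baseS1 = true := by decide +kernel
theorem okS2 : baseOK aS2 fuS2 baseS2 = true := by decide +kernel
theorem okL1 : baseOK aL1 fuL1 baseL1 = true := by decide +kernel

theorem tabL2 : tableOK (progL2.foldl slStep (baseL2.map fun p => p.2.1)) repsL2 tgtL2 = true := by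
  decide +kernel
theorem tabS1 : tableOK (progS1.foldl slStep (baseS1.map fun p => p.2.1)) repsS1 tgtS1 = true := by
  decide +kernel
theorem tabS2 : tableOK (progS2.foldl slStep (baseS2.map fun p => p.2.1)) repsS2 tgtS2 = true := by
  decide +kernel
theorem tabL1 : tableOK (progL1.foldl slStep (baseL1.map fun p => p.2.1)) repsL1 tgtL1 = true := by
  decide +kernel

end HGA

namespace HGA

/-! ### Finite index of the four preimages -/

theorem hL_neg_one (φ : SL2 →* G5) {f : ℤ → ℤ → ℤ → ℤ → V5 → V5}
    (hf : ∀ g, Acts (φ g : M5) (f (g 0 0) (g 0 1) (g 1 0) (g 1 1)))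
    (h1 : ∀ v, f (-1) 0 0 (-1) v = v) : φ (-1) = 1 := by
  refine acts_eq (hf (-1)) acts_oneG ?_
  intro v
  simpa using h1 v

theorem finIdx {Γ : Subgroup G5} (H : HasAB Γ) {φ : SL2 →* G5} {u : ℤ → ℤ → ℤ → G5} {κ : ℤ}
    (hp : Par φ u κ) {fL : ℤ → ℤ → ℤ → ℤ → V5 → V5} {fu : ℤ → ℤ → ℤ → V5 → V5}
    (hL : ∀ g, Acts (φ g : M5) (fL (g 0 0) (g 0 1) (g 1 0) (g 1 1)))
    (hu : ∀ a b c, Acts (u a b c : M5) (fu a b c))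
    {L : List (List ℤ × M2 × ℤ × ℤ × ℤ)} (h : baseOK fL fu L = true)
    {prog : List (ℕ × Bool × ℕ × Bool)} {reps : List M2} {tgt : List (ℕ × ℕ)}
    (ht : tableOK (prog.foldl slStep (L.map fun p => p.2.1)) reps tgt = true)
    (hneg : (-1 : SL2) ∈ hp.P (Gpp Γ)) (N : ℤ) (hN : 0 < N)
    (h1 : u N 0 0 ∈ Gpp Γ) (h2 : u 0 N 0 ∈ Gpp Γ) (h3 : u 0 0 N ∈ Gpp Γ) :
    ((Gpp Γ).comap φ).FiniteIndex := by
  obtain ⟨R, hR, hPR⟩ := tableOK_cover hneg (slRun_mem prog (baseOK_mem H hp hL hu h)) ht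
  exact hp.finiteIndex (Gpp Γ) N hN h1 h2 h3 R hR hPR

theorem up_pow (n : ℕ) : up 1 ^ n = up n := by
  induction n with
  | zero => decide
  | succ n ih => rw [pow_succ, ih, ← up_add]; push_cast; rfl

theorem lo_pow (n : ℕ) : lo 1 ^ n = lo n := by
  induction n with
  | zero => decide
  | succ n ih => rw [pow_succ, ih, ← lo_add]; push_cast; rfl

theorem exists_up {S : Subgroup SL2} (h : S.FiniteIndex) : ∃ n : ℤ, 0 < n ∧ up n ∈ S ∧ lo n ∈ S := by
  obtain ⟨n, hn, -, h1⟩ := Subgroup.exists_pow_mem_of_index_ne_zero h.index_ne_zero (up 1)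
  obtain ⟨m, hm, -, h2⟩ := Subgroup.exists_pow_mem_of_index_ne_zero h.index_ne_zero (lo 1)
  refine ⟨(n * m : ℕ), by positivity, ?_, ?_⟩
  · rw [← up_pow, pow_mul]; exact S.pow_mem h1 m
  · rw [← lo_pow, mul_comm, pow_mul]; exact S.pow_mem h2 n

theorem up_mul_mem {S : Subgroup SL2} {n : ℤ} (h : up n ∈ S) (k : ℤ) : up (n * k) ∈ S :=
  zmul_mem S up up_add n h k
theorem lo_mul_mem {S : Subgroup SL2} {n : ℤ} (h : lo n ∈ S) (k : ℤ) : lo (n * k) ∈ S :=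
  zmul_mem S lo lo_add n h k

theorem up_zero : up 0 = 1 := by decide
theorem lo_zero : lo 0 = 1 := by decide

theorem uL2_mem {Γ : Subgroup G5} (H : HasAB Γ) :
    uL2 72 0 0 ∈ Gpp Γ ∧ uL2 0 72 0 ∈ Gpp Γ ∧ uL2 0 0 72 ∈ Gpp Γ := by
  have c1 : uL2 18 0 0 ∈ Gpp Γ := cert H [-6] (uL2_acts _ _ _) (by decide +kernel)
  have c2 : uL2 0 0 12 ∈ Gpp Γ :=
    cert H [0, 2, 1, 4, 1, -1, -2, 2, 5, 1, -1, -1, 2, 1, -1, -4, -1, -2] (uL2_acts _ _ _)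
      (by decide +kernel)
  have c3 : uL2 (-450) (-72) 12 ∈ Gpp Γ :=
    cert H [2, 1, 5, 1, 3] (uL2_acts _ _ _) (by decide +kernel)
  have k1 := fun k => zmul_mem (Gpp Γ) (fun n => uL2 n 0 0) (by intro m n; simp [parL2.mul]) _ c1 k
  have k3 := fun k => zmul_mem (Gpp Γ) (fun n => uL2 0 0 n) (by intro m n; simp [parL2.mul]) _ c2 k
  refine ⟨k1 4, ?_, k3 6⟩
  have h := (Gpp Γ).inv_mem ((Gpp Γ).mul_mem ((Gpp Γ).mul_mem c3 (k1 25)) (k3 (-1)))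
  simp only [parL2.mul, parL2.inv] at h
  norm_num at h
  exact h

theorem uL2_a (n : ℤ) : uL2 n 0 0 = hS1 (up n) := by simp [uL2, up_zero]
theorem uL2_b (n : ℤ) : uL2 0 n 0 = hL1 (up n) := by simp [uL2, up_zero]
theorem uL2_c (n : ℤ) : uL2 0 0 n = hS2 (up n) := by simp [uL2, up_zero]
theorem uS1_a (n : ℤ) : uS1 n 0 0 = hL1 (up n) := by simp [uS1, up_zero]
theorem uS1_b (n : ℤ) : uS1 0 n 0 = hL2 (up n) := by simp [uS1, up_zero]
theorem uS1_c (n : ℤ) : uS1 0 0 n = hS2 (up n) := by simp [uS1, up_zero]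
theorem uS2_a (n : ℤ) : uS2 n 0 0 = hL1 (up n) := by simp [uS2, up_zero, lo_zero]
theorem uS2_b (n : ℤ) : uS2 0 n 0 = hL2 (lo n) := by simp [uS2, up_zero, lo_zero]
theorem uS2_c (n : ℤ) : uS2 0 0 n = hS1 (up n) := by simp [uS2, up_zero, lo_zero]
theorem uL1_a (n : ℤ) : uL1 n 0 0 = hS1 (up n) := by simp [uL1, up_zero, lo_zero]
theorem uL1_b (n : ℤ) : uL1 0 n 0 = hL2 (lo n) := by simp [uL1, up_zero, lo_zero]
theorem uL1_c (n : ℤ) : uL1 0 0 n = hS2 (lo n) := by simp [uL1, up_zero, lo_zero]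

theorem finL2 {Γ : Subgroup G5} (H : HasAB Γ) : ((Gpp Γ).comap hL2).FiniteIndex := by
  obtain ⟨h1, h2, h3⟩ := uL2_mem H
  refine finIdx H parL2 hL2_acts uL2_acts okL2 tabL2 ?_ 72 (by norm_num) h1 h2 h3
  refine ⟨0, 0, 0, ?_⟩
  rw [parL2.one, hL_neg_one hL2 hL2_acts (by intro v; simp [aL2]), mul_one]
  exact (Gpp Γ).one_mem

theorem upMem {Γ : Subgroup G5} (H : HasAB Γ) : ∃ N : ℤ, 0 < N ∧ hS1 (up N) ∈ Gpp Γ ∧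
    hL1 (up N) ∈ Gpp Γ ∧ hS2 (up N) ∈ Gpp Γ ∧ hL2 (up N) ∈ Gpp Γ ∧ hL2 (lo N) ∈ Gpp Γ := by
  obtain ⟨h1, h2, h3⟩ := uL2_mem H
  obtain ⟨n, hn, h4, h5⟩ := exists_up (finL2 H)
  rw [uL2_a] at h1
  rw [uL2_b] at h2
  rw [uL2_c] at h3
  refine ⟨72 * n, by positivity, ?_, ?_, ?_, ?_, ?_⟩
  · exact up_mul_mem (S := (Gpp Γ).comap hS1) h1 n
  · exact up_mul_mem (S := (Gpp Γ).comap hL1) h2 n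
  · exact up_mul_mem (S := (Gpp Γ).comap hS2) h3 n
  · rw [mul_comm]; exact up_mul_mem (S := (Gpp Γ).comap hL2) h4 72
  · rw [mul_comm]; exact lo_mul_mem (S := (Gpp Γ).comap hL2) h5 72

theorem finS1 {Γ : Subgroup G5} (H : HasAB Γ) : ((Gpp Γ).comap hS1).FiniteIndex := by
  obtain ⟨N, hN, h1, h2, h3, h4, h5⟩ := upMem H
  refine finIdx H parS1 hS1_acts uS1_acts okS1 tabS1 ?_ N hN ?_ ?_ ?_
  · rw [parS1.mem_P]
    refine ⟨-6, 4, -30, ?_⟩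
    have e : Acts (hS1 (-1) : M5) (aS1 (-1) 0 0 (-1)) := by simpa using hS1_acts (-1)
    have k : hS1 (-1) * uS1 (-6) 4 (-30) ∈ Gpp Γ :=
      cert H [0, -2, 1, 4, 1, 5, 1, 5, 1, 4, 1] (acts_mul e (uS1_acts _ _ _)) (by decide +kernel)
    exact k
  · rw [uS1_a]; exact h2
  · rw [uS1_b]; exact h4
  · rw [uS1_c]; exact h3

theorem finS2 {Γ : Subgroup G5} (H : HasAB Γ) : ((Gpp Γ).comap hS2).FiniteIndex := by
  obtain ⟨N, hN, h1, h2, h3, h4, h5⟩ := upMem H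
  refine finIdx H parS2 hS2_acts uS2_acts okS2 tabS2 ?_ N hN ?_ ?_ ?_
  · have := (baseOK_mem H parS2 hS2_acts uS2_acts okS2 ⟨1, -1, 1, 0⟩ (by decide)).2
    have h := (parS2.P (Gpp Γ)).pow_mem this 3
    have e : (⟨1, -1, 1, 0⟩ : M2).sl ^ 3 = -1 := by decide
    rwa [e] at h
  · rw [uS2_a]; exact h2
  · rw [uS2_b]; exact h5
  · rw [uS2_c]; exact h1

theorem finL1 {Γ : Subgroup G5} (H : HasAB Γ) : ((Gpp Γ).comap hL1).FiniteIndex := by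
  obtain ⟨N, hN, h1, h2, h3, h4, h5⟩ := upMem H
  obtain ⟨n, hn, h6, h7⟩ := exists_up (finS2 H)
  refine finIdx H parL1 hL1_acts uL1_acts okL1 tabL1 ?_ (N * n) (by positivity) ?_ ?_ ?_
  · refine ⟨0, 0, 0, ?_⟩
    rw [parL1.one, hL_neg_one hL1 hL1_acts (by intro v; simp [aL1]), mul_one]
    exact (Gpp Γ).one_mem
  · rw [uL1_a]; exact up_mul_mem (S := (Gpp Γ).comap hS1) h1 n
  · rw [uL1_b]; exact lo_mul_mem (S := (Gpp Γ).comap hL2) h5 n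
  · rw [uL1_c, mul_comm]; exact lo_mul_mem h7 N

end HGA

namespace HGA

/-! ### A large subgroup normalized by the root subgroups -/

/-- Congruence to the identity modulo `N`. -/
def Cong (N : ℤ) (g : SL2) : Prop :=
  g 0 0 ≡ 1 [ZMOD N] ∧ g 0 1 ≡ 0 [ZMOD N] ∧ g 1 0 ≡ 0 [ZMOD N] ∧ g 1 1 ≡ 1 [ZMOD N]

/-- The conjugation relation with congruence control. -/
def ConjCong (φ : SL2 →* G5) (u : ℤ → ℤ → ℤ → G5) : Prop :=
  ∀ N g a b c, Cong N g → ∃ a' b' c', u a b c * φ g = φ g * u a' b' c' ∧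
    a' ≡ a [ZMOD N] ∧ b' ≡ b [ZMOD N] ∧ c' ≡ c [ZMOD N]

theorem conjL2 : ConjCong hL2 uL2 := by
  intro N g a b c hg
  have hd := det_eq g
  obtain ⟨h1, h2, h3, h4⟩ := hg
  generalize hp : g 0 0 = p at *
  generalize hq : g 0 1 = q at *
  generalize hr : g 1 0 = r at *
  generalize hs : g 1 1 = s at *
  refine ⟨p ^ 2 * a + 2 * r * p * b - r ^ 2 * c, (p * s + q * r) * b + p * q * a - r * s * c,
    s ^ 2 * c - 2 * s * q * b - q ^ 2 * a, ?_, ?_, ?_, ?_⟩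
  · refine acts_eq (acts_mul (uL2_acts _ _ _) (hL2_acts g))
      (acts_mul (hL2_acts g) (uL2_acts _ _ _)) ?_
    rw [hp, hq, hr, hs]
    intro v; ext <;> simp only [aS1, aS2, aL1, aL2] <;> grind
  · calc _ ≡ 1 ^ 2 * a + 2 * 0 * 1 * b - 0 ^ 2 * c [ZMOD N] := by gcongr
      _ = a := by ring
  · calc _ ≡ (1 * 1 + 0 * 0) * b + 1 * 0 * a - 0 * 1 * c [ZMOD N] := by gcongr
      _ = b := by ring
  · calc _ ≡ 1 ^ 2 * c - 2 * 1 * 0 * b - 0 ^ 2 * a [ZMOD N] := by gcongr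
      _ = c := by ring

theorem conjL1 : ConjCong hL1 uL1 := by
  intro N g a b c hg
  have hd := det_eq g
  obtain ⟨h1, h2, h3, h4⟩ := hg
  generalize hp : g 0 0 = p at *
  generalize hq : g 0 1 = q at *
  generalize hr : g 1 0 = r at *
  generalize hs : g 1 1 = s at *
  refine ⟨s ^ 2 * a - 2 * s * q * b + q ^ 2 * c, (p * s + q * r) * b - p * q * c - r * s * a,
      p ^ 2 * c - 2 * r * p * b + r ^ 2 * a, ?_, ?_, ?_, ?_⟩
  · refine acts_eq (acts_mul (uL1_acts _ _ _) (hL1_acts g))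
      (acts_mul (hL1_acts g) (uL1_acts _ _ _)) ?_
    rw [hp, hq, hr, hs]
    intro v; ext <;> simp only [aS1, aS2, aL1, aL2] <;> grind
  · calc _ ≡ 1 ^ 2 * a - 2 * 1 * 0 * b + 0 ^ 2 * c [ZMOD N] := by gcongr
      _ = a := by ring
  · calc _ ≡ (1 * 1 + 0 * 0) * b - 1 * 0 * c - 0 * 1 * a [ZMOD N] := by gcongr
      _ = b := by ring
  · calc _ ≡ 1 ^ 2 * c - 2 * 0 * 1 * b + 0 ^ 2 * a [ZMOD N] := by gcongr
      _ = c := by ring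

theorem conjS1 : ConjCong hS1 uS1 := by
  intro N g a b c hg
  have hd := det_eq g
  obtain ⟨h1, h2, h3, h4⟩ := hg
  generalize hp : g 0 0 = p at *
  generalize hq : g 0 1 = q at *
  generalize hr : g 1 0 = r at *
  generalize hs : g 1 1 = s at *
  refine ⟨s * a - q * b, p * b - r * a, c - a * b + (s * a - q * b) * (p * b - r * a),
    ?_, ?_, ?_, ?_⟩
  · refine acts_eq (acts_mul (uS1_acts _ _ _) (hS1_acts g))
      (acts_mul (hS1_acts g) (uS1_acts _ _ _)) ?_
    rw [hp, hq, hr, hs]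
    intro v; ext <;> simp only [aS1, aS2, aL1, aL2] <;> grind
  · calc _ ≡ 1 * a - 0 * b [ZMOD N] := by gcongr
      _ = a := by ring
  · calc _ ≡ 1 * b - 0 * a [ZMOD N] := by gcongr
      _ = b := by ring
  · calc _ ≡ c - a * b + (1 * a - 0 * b) * (1 * b - 0 * a) [ZMOD N] := by gcongr
      _ = c := by ring

theorem conjS2 : ConjCong hS2 uS2 := by
  intro N g a b c hg
  have hd := det_eq g
  obtain ⟨h1, h2, h3, h4⟩ := hg
  generalize hp : g 0 0 = p at *
  generalize hq : g 0 1 = q at *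
  generalize hr : g 1 0 = r at *
  generalize hs : g 1 1 = s at *
  refine ⟨s * a + q * b, p * b + r * a, c + a * b - (s * a + q * b) * (p * b + r * a),
    ?_, ?_, ?_, ?_⟩
  · refine acts_eq (acts_mul (uS2_acts _ _ _) (hS2_acts g))
      (acts_mul (hS2_acts g) (uS2_acts _ _ _)) ?_
    rw [hp, hq, hr, hs]
    intro v; ext <;> simp only [aS1, aS2, aL1, aL2] <;> grind
  · calc _ ≡ 1 * a + 0 * b [ZMOD N] := by gcongr
      _ = a := by ring
  · calc _ ≡ 1 * b + 0 * a [ZMOD N] := by gcongr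
      _ = b := by ring
  · calc _ ≡ c + a * b - (1 * a + 0 * b) * (1 * b + 0 * a) [ZMOD N] := by gcongr
      _ = c := by ring

/-- Unipotent elements conjugate the congruence part of `φ` into `K`. -/
theorem conj_mem {φ : SL2 →* G5} {u : ℤ → ℤ → ℤ → G5} {κ : ℤ} (hp : Par φ u κ)
    (hc : ConjCong φ u) (K : Subgroup G5) (N : ℤ) (h1 : u N 0 0 ∈ K) (h2 : u 0 N 0 ∈ K)
    (h3 : u 0 0 N ∈ K) {g : SL2} (hg : φ g ∈ K) (hgN : Cong N g) (a b c : ℤ) :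
    u a b c * φ g * (u a b c)⁻¹ ∈ K := by
  obtain ⟨a', b', c', e, ha, hb, hc⟩ := hc N g a b c hgN
  rw [e, mul_assoc]
  apply K.mul_mem hg
  rw [hp.inv, hp.mul]
  have k1 := fun k => zmul_mem K (fun n => u n 0 0) (by intro m n; simp [hp.mul]) N h1 k
  have k2 := fun k => zmul_mem K (fun n => u 0 n 0) (by intro m n; simp [hp.mul]) N h2 k
  have k3 := fun k => zmul_mem K (fun n => u 0 0 n) (by intro m n; simp [hp.mul]) N h3 k
  obtain ⟨x, hx⟩ := ha.symm.dvd
  obtain ⟨y, hy⟩ := hb.symm.dvd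
  obtain ⟨z, hz⟩ := hc.symm.dvd
  have := K.mul_mem (K.mul_mem (k1 x) (k2 y)) (k3 (z - κ * a * y))
  simp only [hp.mul] at this
  convert this using 2
  · linarith
  · linarith
  · linear_combination hz - κ * a * hy

/-! Some relations between the root groups. -/

theorem comm_S1_S2 (g h : SL2) : hS1 g * hS2 h = hS2 h * hS1 g := by
  refine acts_eq (acts_mul (hS1_acts g) (hS2_acts h)) (acts_mul (hS2_acts h) (hS1_acts g)) ?_
  intro v; ext <;> simp only [aS1, aS2] <;> ring

/-- The twist. -/
def tw (g : SL2) : SL2 := ⟨!![g 0 0, -g 0 1; -g 1 0, g 1 1], by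
  rw [Matrix.det_fin_two_of]; linarith [det_eq g]⟩

def twHom : SL2 →* SL2 where
  toFun := tw
  map_one' := by decide
  map_mul' := by
    intro g h
    apply Subtype.ext
    rw [Matrix.SpecialLinearGroup.coe_mul]
    simp only [tw, Matrix.SpecialLinearGroup.coe_mul, Matrix.mul_apply, Fin.sum_univ_two]
    ext i j
    fin_cases i <;> fin_cases j <;> simp <;> ring

theorem tw_tw (g : SL2) : tw (tw g) = g := by
  apply Subtype.ext
  ext i j
  fin_cases i <;> fin_cases j <;> simp [tw]

def sS : SL2 := ⟨!![0, -1; 1, 0], by simp⟩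

/-- The twisted conjugate by `sS`. -/
def stw (g : SL2) : SL2 := ⟨!![g 1 1, g 1 0; g 0 1, g 0 0], by
  rw [Matrix.det_fin_two_of]; linarith [det_eq g]⟩

theorem stw_eq (g : SL2) : stw g = sS * tw g * sS⁻¹ := by
  rw [eq_mul_inv_iff_mul_eq]
  apply Subtype.ext
  rw [Matrix.SpecialLinearGroup.coe_mul, Matrix.SpecialLinearGroup.coe_mul]
  ext i j
  fin_cases i <;> fin_cases j <;> simp [Matrix.mul_apply, Fin.sum_univ_two, stw, sS, tw]

def th : G5 := hS1 sS * hS2 sS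

theorem acts_sS1 : Acts (hS1 sS : M5) (aS1 0 (-1) 1 0) := hS1_acts sS
theorem acts_sS2 : Acts (hS2 sS : M5) (aS2 0 (-1) 1 0) := hS2_acts sS
theorem acts_sL1 : Acts (hL1 sS : M5) (aL1 0 (-1) 1 0) := hL1_acts sS

theorem th_L1 (g : SL2) : th * hL1 g = hL1 (stw g) * th := by
  have e : Acts (hL1 (stw g) : M5) (aL1 (g 1 1) (g 1 0) (g 0 1) (g 0 0)) := hL1_acts (stw g)
  refine acts_eq (acts_mul (acts_mul acts_sS1 acts_sS2) (hL1_acts g))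
    (acts_mul e (acts_mul acts_sS1 acts_sS2)) ?_
  intro v; ext <;> simp [aS1, aS2, aL1] <;> ring

theorem th_L2 (g : SL2) : th * hL2 g = hL2 (stw g) * th := by
  have e : Acts (hL2 (stw g) : M5) (aL2 (g 1 1) (g 1 0) (g 0 1) (g 0 0)) := hL2_acts (stw g)
  refine acts_eq (acts_mul (acts_mul acts_sS1 acts_sS2) (hL2_acts g))
    (acts_mul e (acts_mul acts_sS1 acts_sS2)) ?_
  intro v; ext <;> simp [aS1, aS2, aL2] <;> ring

theorem s_L1 (g : SL2) : hS1 sS * hL1 g = hL2 g * hS1 sS := by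
  refine acts_eq (acts_mul acts_sS1 (hL1_acts g)) (acts_mul (hL2_acts g) acts_sS1) ?_
  intro v; ext <;> simp [aS1, aL1, aL2] <;> ring

theorem s_S1 (g : SL2) : hL1 sS * hS1 g = hS2 (stw g) * hL1 sS := by
  have e : Acts (hS2 (stw g) : M5) (aS2 (g 1 1) (g 1 0) (g 0 1) (g 0 0)) := hS2_acts (stw g)
  refine acts_eq (acts_mul acts_sL1 (hS1_acts g)) (acts_mul e acts_sL1) ?_
  intro v; ext <;> simp [aS1, aL1, aS2] <;> ring

theorem stw_stw (g : SL2) : stw (stw g) = g := by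
  apply Subtype.ext
  ext i j
  fin_cases i <;> fin_cases j <;> simp [stw]

/-! ### The group `K` -/

/-- The smallest subgroup containing the images of `Λ`. -/
def KL (Λ : Subgroup SL2) : Subgroup G5 :=
  Λ.map hS1 ⊔ Λ.map hS2 ⊔ Λ.map hL1 ⊔ Λ.map hL2

theorem KL_S1 {Λ : Subgroup SL2} {g : SL2} (h : g ∈ Λ) : hS1 g ∈ KL Λ :=
  Subgroup.mem_sup_left (Subgroup.mem_sup_left (Subgroup.mem_sup_left ⟨g, h, rfl⟩))
theorem KL_S2 {Λ : Subgroup SL2} {g : SL2} (h : g ∈ Λ) : hS2 g ∈ KL Λ :=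
  Subgroup.mem_sup_left (Subgroup.mem_sup_left (Subgroup.mem_sup_right ⟨g, h, rfl⟩))
theorem KL_L1 {Λ : Subgroup SL2} {g : SL2} (h : g ∈ Λ) : hL1 g ∈ KL Λ :=
  Subgroup.mem_sup_left (Subgroup.mem_sup_right ⟨g, h, rfl⟩)
theorem KL_L2 {Λ : Subgroup SL2} {g : SL2} (h : g ∈ Λ) : hL2 g ∈ KL Λ :=
  Subgroup.mem_sup_right ⟨g, h, rfl⟩

theorem conj_le {Λ : Subgroup SL2} {x : G5} (h1 : ∀ g ∈ Λ, x * hS1 g * x⁻¹ ∈ KL Λ)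
    (h2 : ∀ g ∈ Λ, x * hS2 g * x⁻¹ ∈ KL Λ) (h3 : ∀ g ∈ Λ, x * hL1 g * x⁻¹ ∈ KL Λ)
    (h4 : ∀ g ∈ Λ, x * hL2 g * x⁻¹ ∈ KL Λ) : ∀ k ∈ KL Λ, x * k * x⁻¹ ∈ KL Λ := by
  have : KL Λ ≤ (KL Λ).comap (MulAut.conj x).toMonoidHom := by
    refine sup_le (sup_le (sup_le ?_ ?_) ?_) ?_ <;> rintro _ ⟨g, hg, rfl⟩
    · exact h1 g hg
    · exact h2 g hg
    · exact h3 g hg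
    · exact h4 g hg
  intro k hk
  exact this hk

theorem mem_norm {K : Subgroup G5} {x : G5} (h1 : ∀ k ∈ K, x * k * x⁻¹ ∈ K)
    (h2 : ∀ k ∈ K, x⁻¹ * k * x ∈ K) : x ∈ Subgroup.normalizer (K : Set G5) := by
  rw [Subgroup.mem_normalizer_iff]
  intro h
  refine ⟨h1 h, fun hh => ?_⟩
  have := h2 _ hh
  convert this using 1
  group

/-- The conditions on `Λ`. -/
structure Good (Λ : Subgroup SL2) (N : ℤ) : Prop where
  normal : Λ.Normal
  twist : ∀ g ∈ Λ, tw g ∈ Λ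
  cong : ∀ g ∈ Λ, Cong N g
  upN : up N ∈ Λ
  loN : lo N ∈ Λ

variable {Λ : Subgroup SL2} {N : ℤ}

theorem Good.stw (h : Good Λ N) {g : SL2} (hg : g ∈ Λ) : stw g ∈ Λ := by
  rw [stw_eq]; exact h.normal.conj_mem _ (h.twist g hg) _

theorem up_neg (n : ℤ) : up (-n) = (up n)⁻¹ := by
  rw [eq_inv_iff_mul_eq_one, ← up_add, neg_add_cancel, up_zero]
theorem lo_neg (n : ℤ) : lo (-n) = (lo n)⁻¹ := by
  rw [eq_inv_iff_mul_eq_one, ← lo_add, neg_add_cancel, lo_zero]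

theorem Good.upS1_conj (h : Good Λ N) (n : ℤ) :
    ∀ k ∈ KL Λ, hS1 (up n) * k * (hS1 (up n))⁻¹ ∈ KL Λ := by
  apply conj_le
  · intro g hg
    rw [← map_inv, ← map_mul, ← map_mul]
    exact KL_S1 (h.normal.conj_mem _ hg _)
  · intro g hg
    rw [comm_S1_S2, mul_inv_cancel_right]
    exact KL_S2 hg
  · intro g hg
    rw [← uL1_a]
    refine conj_mem parL1 conjL1 _ N ?_ ?_ ?_ (KL_L1 hg) (h.cong g hg) _ _ _
    · rw [uL1_a]; exact KL_S1 h.upN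
    · rw [uL1_b]; exact KL_L2 h.loN
    · rw [uL1_c]; exact KL_S2 h.loN
  · intro g hg
    rw [← uL2_a]
    refine conj_mem parL2 conjL2 _ N ?_ ?_ ?_ (KL_L2 hg) (h.cong g hg) _ _ _
    · rw [uL2_a]; exact KL_S1 h.upN
    · rw [uL2_b]; exact KL_L1 h.upN
    · rw [uL2_c]; exact KL_S2 h.upN

theorem Good.upL1_conj (h : Good Λ N) (n : ℤ) :
    ∀ k ∈ KL Λ, hL1 (up n) * k * (hL1 (up n))⁻¹ ∈ KL Λ := by
  apply conj_le
  · intro g hg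
    rw [← uS1_a]
    refine conj_mem parS1 conjS1 _ N ?_ ?_ ?_ (KL_S1 hg) (h.cong g hg) _ _ _
    · rw [uS1_a]; exact KL_L1 h.upN
    · rw [uS1_b]; exact KL_L2 h.upN
    · rw [uS1_c]; exact KL_S2 h.upN
  · intro g hg
    rw [← uS2_a]
    refine conj_mem parS2 conjS2 _ N ?_ ?_ ?_ (KL_S2 hg) (h.cong g hg) _ _ _
    · rw [uS2_a]; exact KL_L1 h.upN
    · rw [uS2_b]; exact KL_L2 h.loN
    · rw [uS2_c]; exact KL_S1 h.upN
  · intro g hg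
    rw [← map_inv, ← map_mul, ← map_mul]
    exact KL_L1 (h.normal.conj_mem _ hg _)
  · intro g hg
    rw [← uL2_b]
    refine conj_mem parL2 conjL2 _ N ?_ ?_ ?_ (KL_L2 hg) (h.cong g hg) _ _ _
    · rw [uL2_a]; exact KL_S1 h.upN
    · rw [uL2_b]; exact KL_L1 h.upN
    · rw [uL2_c]; exact KL_S2 h.upN

theorem th_S1 (g : SL2) : th * hS1 g * th⁻¹ = hS1 (sS * g * sS⁻¹) := by
  rw [mul_inv_eq_iff_eq_mul, th, mul_assoc, ← comm_S1_S2, ← mul_assoc, ← mul_assoc, ← map_mul,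
    ← map_mul, inv_mul_cancel_right]

theorem Good.th_conj (h : Good Λ N) : ∀ k ∈ KL Λ, th * k * th⁻¹ ∈ KL Λ := by
  apply conj_le
  · intro g hg
    rw [th_S1]; exact KL_S1 (h.normal.conj_mem _ hg _)
  · intro g hg
    have e : th * hS2 g * th⁻¹ = hS2 (sS * g * sS⁻¹) := by
      rw [mul_inv_eq_iff_eq_mul, th, comm_S1_S2, mul_assoc, comm_S1_S2, ← mul_assoc, ← mul_assoc,
        ← map_mul, ← map_mul, inv_mul_cancel_right]
    rw [e]; exact KL_S2 (h.normal.conj_mem _ hg _)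
  · intro g hg
    rw [th_L1, mul_inv_cancel_right]; exact KL_L1 (h.stw hg)
  · intro g hg
    rw [th_L2, mul_inv_cancel_right]; exact KL_L2 (h.stw hg)

theorem Good.th_conj' (h : Good Λ N) : ∀ k ∈ KL Λ, th⁻¹ * k * th ∈ KL Λ := by
  have e : th⁻¹ = th * (th * th) := by
    rw [inv_eq_iff_mul_eq_one]
    have : sS * (sS * (sS * sS)) = 1 := by decide
    have e2 : th * th = hS1 (sS * sS) * hS2 (sS * sS) := by
      simp only [th, map_mul]
      rw [mul_assoc, ← mul_assoc (hS2 sS), ← comm_S1_S2]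
      simp only [mul_assoc]
    have e3 : (th * th) * (th * th) = 1 := by
      have k : sS * sS * (sS * sS) = 1 := by decide
      rw [e2, mul_assoc, ← mul_assoc (hS2 _), ← comm_S1_S2, mul_assoc, ← map_mul, ← mul_assoc,
        ← map_mul, k, map_one, map_one, mul_one]
    rw [← e3]; simp only [mul_assoc]
  intro k hk
  have := h.th_conj _ (h.th_conj _ (h.th_conj k hk))
  have e' : th = (th * (th * th))⁻¹ := by rw [← e, inv_inv]
  rw [e]
  conv => enter [2, 2]; rw [e']
  convert this using 1
  group

theorem Good.upS1 (h : Good Λ N) (n : ℤ) :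
    hS1 (up n) ∈ Subgroup.normalizer (KL Λ : Set G5) := by
  apply mem_norm (h.upS1_conj n)
  have := h.upS1_conj (-n)
  rwa [up_neg, map_inv, inv_inv] at this

theorem Good.upL1 (h : Good Λ N) (n : ℤ) :
    hL1 (up n) ∈ Subgroup.normalizer (KL Λ : Set G5) := by
  apply mem_norm (h.upL1_conj n)
  have := h.upL1_conj (-n)
  rwa [up_neg, map_inv, inv_inv] at this

theorem Good.th_mem (h : Good Λ N) : th ∈ Subgroup.normalizer (KL Λ : Set G5) :=
  mem_norm h.th_conj h.th_conj'

theorem gen_top (S : Subgroup SL2) (h1 : ∀ n, up n ∈ S) (h2 : lo 1 ∈ S ∨ lo (-1) ∈ S) (g : SL2) :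
    g ∈ S := by
  have h3 : lo 1 ∈ S := by
    rcases h2 with h2 | h2
    · exact h2
    · rw [lo_neg] at h2
      exact inv_inv (lo 1) ▸ S.inv_mem h2
  have hT : ModularGroup.T ∈ S := by
    have : ModularGroup.T = up 1 := by decide
    rw [this]; exact h1 1
  have hS : ModularGroup.S ∈ S := by
    have : ModularGroup.S = up (-1) * lo 1 * up (-1) := by decide
    rw [this]; exact S.mul_mem (S.mul_mem (h1 _) h3) (h1 _)
  have : Subgroup.closure {ModularGroup.S, ModularGroup.T} ≤ S := by
    rw [Subgroup.closure_le]
    rintro x (rfl | rfl)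
    · exact hS
    · exact hT
  apply this
  rw [SpecialLinearGroup.SL2Z_generators]; trivial

theorem Good.nS1 (h : Good Λ N) (g : SL2) : hS1 g ∈ Subgroup.normalizer (KL Λ : Set G5) := by
  refine gen_top ((Subgroup.normalizer (KL Λ : Set G5)).comap hS1) (fun n => h.upS1 n) ?_ g
  right
  have e : hS1 (lo (-1)) = th * hS1 (up 1) * th⁻¹ := by
    have : lo (-1) = sS * up 1 * sS⁻¹ := by decide
    rw [this, th_S1]
  rw [Subgroup.mem_comap, e]
  exact Subgroup.mul_mem _ (Subgroup.mul_mem _ h.th_mem (h.upS1 1)) (Subgroup.inv_mem _ h.th_mem)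

theorem Good.nL1 (h : Good Λ N) (g : SL2) : hL1 g ∈ Subgroup.normalizer (KL Λ : Set G5) := by
  refine gen_top ((Subgroup.normalizer (KL Λ : Set G5)).comap hL1) (fun n => h.upL1 n) ?_ g
  left
  have e : hL1 (lo 1) = th * hL1 (up 1) * th⁻¹ := by
    have : lo 1 = HGA.stw (up 1) := by decide
    rw [th_L1, mul_inv_cancel_right, this]
  rw [Subgroup.mem_comap, e]
  exact Subgroup.mul_mem _ (Subgroup.mul_mem _ h.th_mem (h.upL1 1)) (Subgroup.inv_mem _ h.th_mem)

theorem Good.nL2 (h : Good Λ N) (g : SL2) : hL2 g ∈ Subgroup.normalizer (KL Λ : Set G5) := by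
  have e : hL2 g = hS1 sS * hL1 g * (hS1 sS)⁻¹ := by rw [s_L1, mul_inv_cancel_right]
  rw [e]
  exact Subgroup.mul_mem _ (Subgroup.mul_mem _ (h.nS1 _) (h.nL1 _)) (Subgroup.inv_mem _ (h.nS1 _))

theorem Good.nS2 (h : Good Λ N) (g : SL2) : hS2 g ∈ Subgroup.normalizer (KL Λ : Set G5) := by
  have e : hS2 g = hL1 sS * hS1 (HGA.stw g) * (hL1 sS)⁻¹ := by
    rw [s_S1, mul_inv_cancel_right, stw_stw]
  rw [e]
  exact Subgroup.mul_mem _ (Subgroup.mul_mem _ (h.nL1 _) (h.nS1 _)) (Subgroup.inv_mem _ (h.nL1 _))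

end HGA

namespace HGA

theorem gamma_cong {n : ℕ} {g : SL2} : g ∈ CongruenceSubgroup.Gamma n ↔ Cong n g := by
  rw [CongruenceSubgroup.Gamma_mem, Cong, ← ZMod.intCast_eq_intCast_iff,
    ← ZMod.intCast_eq_intCast_iff, ← ZMod.intCast_eq_intCast_iff, ← ZMod.intCast_eq_intCast_iff]
  simp

theorem exists_good (C : Subgroup SL2) (hC : C.FiniteIndex) :
    ∃ (Λ : Subgroup SL2) (N : ℤ), Λ ≤ C ∧ Λ.FiniteIndex ∧ Good Λ N := by
  let D : Subgroup SL2 := C.normalCore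
  have hDn : D.Normal := inferInstance
  have hDf : D.FiniteIndex := inferInstance
  let E : Subgroup SL2 := D ⊓ D.comap twHom
  have hEn : E.Normal := inferInstance
  have hT : (D.comap twHom).FiniteIndex := by
    refine finiteIndex_of_coloring _ (fun g => (QuotientGroup.mk (twHom g)⁻¹ : SL2 ⧸ D)) ?_
    intro s t hst
    have := QuotientGroup.eq.mp hst
    rw [Subgroup.mem_comap, map_mul, map_inv]
    rwa [inv_inv] at this
  have hEf : E.FiniteIndex := inferInstance
  obtain ⟨N, hN, h1, h2⟩ := exists_up hEf
  obtain ⟨n, rfl⟩ := Int.eq_ofNat_of_zero_le hN.le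
  have hn : NeZero n := ⟨by rintro rfl; simp at hN⟩
  have hGn : (CongruenceSubgroup.Gamma n).Normal := CongruenceSubgroup.Gamma_normal n
  have hGf : (CongruenceSubgroup.Gamma n).FiniteIndex := inferInstance
  refine ⟨E ⊓ CongruenceSubgroup.Gamma n, n, ?_, inferInstance, ?_, ?_, ?_, ?_, ?_⟩
  · intro g hg
    exact C.normalCore_le hg.1.1
  · infer_instance
  · rintro g ⟨⟨hg1, hg2⟩, hg3⟩
    refine ⟨⟨hg2, ?_⟩, ?_⟩
    · change tw (tw g) ∈ D
      rw [tw_tw]; exact hg1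
    · obtain ⟨a, b, c, d⟩ := gamma_cong.mp hg3
      refine gamma_cong.mpr ?_
      refine ⟨a, ?_, ?_, d⟩
      · simpa [tw] using b.neg
      · simpa [tw] using c.neg
  · intro g hg
    exact gamma_cong.mp hg.2
  · refine ⟨h1, ?_⟩
    refine gamma_cong.mpr ?_
    simp [Cong, up, Int.ModEq]
  · refine ⟨h2, ?_⟩
    refine gamma_cong.mpr ?_
    simp [Cong, lo, Int.ModEq]

/-- `X` is covered by finitely many cosets of `K`. -/
def Cov (K : Subgroup G5) (X : Set G5) : Prop :=
  ∃ Z : Set G5, Z.Finite ∧ ∀ x ∈ X, ∃ z ∈ Z, x * z⁻¹ ∈ K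

theorem Cov.mul {K : Subgroup G5} {X Y : Set G5} (hX : Cov K X) (hY : Cov K Y)
    (hN : ∀ x ∈ X, x ∈ Subgroup.normalizer (K : Set G5)) :
    Cov K {g | ∃ x ∈ X, ∃ y ∈ Y, g = x * y} := by
  obtain ⟨Z, hZ, hZ'⟩ := hX
  obtain ⟨W, hW, hW'⟩ := hY
  refine ⟨Set.image2 (· * ·) Z W, hZ.image2 _ hW, ?_⟩
  rintro _ ⟨x, hx, y, hy, rfl⟩
  obtain ⟨z, hz, hxz⟩ := hZ' x hx
  obtain ⟨w, hw, hyw⟩ := hW' y hy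
  refine ⟨z * w, ⟨z, hz, w, hw, rfl⟩, ?_⟩
  have := K.mul_mem ((Subgroup.mem_normalizer_iff.mp (hN x hx) _).mp hyw) hxz
  convert this using 1
  group

theorem cov_finite {K : Subgroup G5} {X : Set G5} (h : X.Finite) : Cov K X :=
  ⟨X, h, fun x hx => ⟨x, hx, by simp [K.one_mem]⟩⟩

theorem Cov.mono {K K' : Subgroup G5} {X X' : Set G5} (h : Cov K X) (hK : K ≤ K') (hX : X' ⊆ X) :
    Cov K' X' := by
  obtain ⟨Z, hZ, hZ'⟩ := h
  refine ⟨Z, hZ, fun x hx => ?_⟩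
  obtain ⟨z, hz, h⟩ := hZ' x (hX hx)
  exact ⟨z, hz, hK h⟩

theorem cov_range {K : Subgroup G5} {φ : SL2 →* G5} {Λ : Subgroup SL2} (hΛ : Λ.FiniteIndex)
    (h : ∀ g ∈ Λ, φ g ∈ K) : Cov K (Set.range φ) := by
  refine ⟨Set.range (fun q : SL2 ⧸ Λ => φ q.out⁻¹), Set.finite_range _, ?_⟩
  rintro _ ⟨g, rfl⟩
  refine ⟨_, ⟨(QuotientGroup.mk g⁻¹ : SL2 ⧸ Λ), rfl⟩, ?_⟩
  rw [← map_inv, ← map_mul, inv_inv]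
  apply h
  have : (QuotientGroup.mk g⁻¹ : SL2 ⧸ Λ) = QuotientGroup.mk (QuotientGroup.mk g⁻¹ : SL2 ⧸ Λ).out :=
    (QuotientGroup.out_eq' _).symm
  have := QuotientGroup.eq.mp this
  rwa [inv_inv] at this

/-- Products of the root subgroups according to a list, followed by a finite set. -/
def prodSet (F : Set G5) : List (SL2 →* G5) → Set G5
  | [] => F
  | φ :: l => {g | ∃ x ∈ Set.range φ, ∃ y ∈ prodSet F l, g = x * y}

theorem cov_prod {Γ : Subgroup G5} (H : HasAB Γ) {F : Set G5} (hF : F.Finite)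
    (l : List (SL2 →* G5)) (hl : ∀ φ ∈ l, φ = hS1 ∨ φ = hS2 ∨ φ = hL1 ∨ φ = hL2) :
    Cov (Gpp Γ) (prodSet F l) := by
  have f1 := finS1 H
  have f2 := finS2 H
  have f3 := finL1 H
  have f4 := finL2 H
  obtain ⟨Λ, N, hΛ, hf, hg⟩ := exists_good ((Gpp Γ).comap hS1 ⊓ (Gpp Γ).comap hS2 ⊓
    (Gpp Γ).comap hL1 ⊓ (Gpp Γ).comap hL2) inferInstance
  have hK : KL Λ ≤ Gpp Γ := by
    refine sup_le (sup_le (sup_le ?_ ?_) ?_) ?_ <;> rintro _ ⟨g, hg, rfl⟩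
    · exact (hΛ hg).1.1.1
    · exact (hΛ hg).1.1.2
    · exact (hΛ hg).1.2
    · exact (hΛ hg).2
  suffices Cov (KL Λ) (prodSet F l) from this.mono hK subset_rfl
  induction l with
  | nil => exact cov_finite hF
  | cons φ l ih =>
    refine Cov.mul ?_ (ih fun ψ hψ => hl ψ (List.mem_cons_of_mem _ hψ)) ?_
    · rcases hl φ List.mem_cons_self with rfl | rfl | rfl | rfl
      · exact cov_range hf fun g hg => KL_S1 hg
      · exact cov_range hf fun g hg => KL_S2 hg
      · exact cov_range hf fun g hg => KL_L1 hg
      · exact cov_range hf fun g hg => KL_L2 hg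
    · rintro _ ⟨g, rfl⟩
      rcases hl φ List.mem_cons_self with rfl | rfl | rfl | rfl
      · exact hg.nS1 g
      · exact hg.nS2 g
      · exact hg.nL1 g
      · exact hg.nL2 g

end HGA

namespace HGA

/-! ### The integral orthogonal group of the split form -/

/-- The split bilinear form. -/
def bl (u v : V5) : ℤ := u.x1 * v.y1 + u.y1 * v.x1 + u.x2 * v.y2 + u.y2 * v.x2 + 2 * u.w * v.w

/-- `h` acts through `f`, and `f` is an isometry. -/
def Iso (h : G5) (f : V5 → V5) : Prop := Acts (h : M5) f ∧ ∀ u v, bl (f u) (f v) = bl u v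

def mkSL (a b c d : ℤ) (h : a * d - b * c = 1) : SL2 :=
  ⟨!![a, b; c, d], by rw [Matrix.det_fin_two_of]; exact h⟩

theorem bl_aS1 {a b c d : ℤ} (hd : a * d - b * c = 1) (x y : V5) :
    bl (aS1 a b c d x) (aS1 a b c d y) = bl x y := by
  simp only [bl, aS1]
  linear_combination (x.x1 * y.y1 + x.y1 * y.x1 + x.x2 * y.y2 + x.y2 * y.x2) * hd

theorem Iso.S1 {h : G5} {f : V5 → V5} (hi : Iso h f) (a b c d : ℤ) (hd : a * d - b * c = 1) :
    Iso (hS1 (mkSL a b c d hd) * h) (fun v => aS1 a b c d (f v)) := by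
  refine ⟨acts_mul (hS1_acts (mkSL a b c d hd)) hi.1, fun u v => ?_⟩
  exact (bl_aS1 hd _ _).trans (hi.2 u v)

theorem bl_aS2 {a b c d : ℤ} (hd : a * d - b * c = 1) (x y : V5) :
    bl (aS2 a b c d x) (aS2 a b c d y) = bl x y := by
  simp only [bl, aS2]
  linear_combination (x.x1 * y.y1 + x.y1 * y.x1 + x.x2 * y.y2 + x.y2 * y.x2) * hd

theorem Iso.S2 {h : G5} {f : V5 → V5} (hi : Iso h f) (a b c d : ℤ) (hd : a * d - b * c = 1) :
    Iso (hS2 (mkSL a b c d hd) * h) (fun v => aS2 a b c d (f v)) := by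
  refine ⟨acts_mul (hS2_acts (mkSL a b c d hd)) hi.1, fun u v => ?_⟩
  exact (bl_aS2 hd _ _).trans (hi.2 u v)

theorem bl_aL1 {a b c d : ℤ} (hd : a * d - b * c = 1) (x y : V5) :
    bl (aL1 a b c d x) (aL1 a b c d y) = bl x y := by
  simp only [bl, aL1]
  linear_combination (a * d - b * c + 1) * (x.x1 * y.y1 + x.y1 * y.x1 + 2 * x.w * y.w) * hd

theorem Iso.L1 {h : G5} {f : V5 → V5} (hi : Iso h f) (a b c d : ℤ) (hd : a * d - b * c = 1) :
    Iso (hL1 (mkSL a b c d hd) * h) (fun v => aL1 a b c d (f v)) := by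
  refine ⟨acts_mul (hL1_acts (mkSL a b c d hd)) hi.1, fun u v => ?_⟩
  exact (bl_aL1 hd _ _).trans (hi.2 u v)

theorem bl_aL2 {a b c d : ℤ} (hd : a * d - b * c = 1) (x y : V5) :
    bl (aL2 a b c d x) (aL2 a b c d y) = bl x y := by
  simp only [bl, aL2]
  linear_combination (a * d - b * c + 1) * (x.x2 * y.y2 + x.y2 * y.x2 + 2 * x.w * y.w) * hd

theorem Iso.L2 {h : G5} {f : V5 → V5} (hi : Iso h f) (a b c d : ℤ) (hd : a * d - b * c = 1) :
    Iso (hL2 (mkSL a b c d hd) * h) (fun v => aL2 a b c d (f v)) := by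
  refine ⟨acts_mul (hL2_acts (mkSL a b c d hd)) hi.1, fun u v => ?_⟩
  exact (bl_aL2 hd _ _).trans (hi.2 u v)

theorem step {F : Set G5} {l : List (SL2 →* G5)} {φ : SL2 →* G5} (g : SL2) {h : G5}
    (hh : φ g * h ∈ prodSet F l) : h ∈ prodSet F (φ :: l) :=
  ⟨φ g⁻¹, ⟨_, rfl⟩, _, hh, by rw [map_inv, inv_mul_cancel_left]⟩

def dg (ε δ : ℤ) (v : V5) : V5 := ⟨v.x1, ε * v.x2, δ * v.w, ε * v.y2, v.y1⟩

/-- The diagonal sign matrices. -/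
def FF : Set G5 := {h | ∃ ε ∈ ({1, -1} : Set ℤ), ∃ δ ∈ ({1, -1} : Set ℤ), Acts (h : M5) (dg ε δ)}

theorem FF_finite : FF.Finite := by
  have : FF = ⋃ ε ∈ ({1, -1} : Set ℤ), ⋃ δ ∈ ({1, -1} : Set ℤ), {h : G5 | Acts (h : M5) (dg ε δ)} := by
    ext h; simp [FF]
  rw [this]
  refine Set.Finite.biUnion (by simp) fun ε _ => Set.Finite.biUnion (by simp) fun δ _ => ?_
  apply Set.Subsingleton.finite
  intro h hh h' hh'
  exact acts_eq hh hh' fun v => rfl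

def vE1 : V5 := ⟨1, 0, 0, 0, 0⟩
def vE2 : V5 := ⟨0, 1, 0, 0, 0⟩
def vZ : V5 := ⟨0, 0, 1, 0, 0⟩
def vF2 : V5 := ⟨0, 0, 0, 1, 0⟩
def vF1 : V5 := ⟨0, 0, 0, 0, 1⟩

theorem stage0 {h : G5} {f : V5 → V5} (hi : Iso h f) (ε : ℤ) (hε : ε = 1 ∨ ε = -1)
    (h1 : f vE1 = vE1) (h2 : f vF1 = vF1) (h3 : f vE2 = ⟨0, ε, 0, 0, 0⟩)
    (h4 : f vF2 = ⟨0, 0, 0, ε, 0⟩) : h ∈ FF := by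
  have hε2 : ε * ε = 1 := by rcases hε with rfl | rfl <;> rfl
  have key : ∀ v, (f v).x1 = v.x1 ∧ (f v).y1 = v.y1 ∧ ε * (f v).x2 = v.x2 ∧ ε * (f v).y2 = v.y2 := by
    intro v
    have e1 := hi.2 v vE1
    have e2 := hi.2 v vF1
    have e3 := hi.2 v vE2
    have e4 := hi.2 v vF2
    rw [h1] at e1
    rw [h2] at e2
    rw [h3] at e3
    rw [h4] at e4
    simp [bl, vE1, vE2, vF1, vF2] at e1 e2 e3 e4
    exact ⟨e2, e1, by rw [mul_comm]; exact e4, by rw [mul_comm]; exact e3⟩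
  have key2 : ∀ v, (f v).x2 = ε * v.x2 ∧ (f v).y2 = ε * v.y2 := by
    intro v
    obtain ⟨-, -, k1, k2⟩ := key v
    constructor
    · linear_combination (-(f v).x2) * hε2 + ε * k1
    · linear_combination (-(f v).y2) * hε2 + ε * k2
  have ez := hi.2 vZ vZ
  have kz := key vZ
  have kz2 := key2 vZ
  set δ := (f vZ).w with hδ
  have hδ2 : δ * δ = 1 := by
    simp only [bl] at ez
    rw [kz.1, kz2.1, ← hδ] at ez
    simp only [vZ] at ez
    linarith
  refine ⟨ε, by simpa using hε, δ, ?_, hi.1.congr fun v => ?_⟩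
  · simpa using Int.isUnit_iff.mp (IsUnit.of_mul_eq_one _ hδ2)
  · have e := hi.2 v vZ
    simp only [bl] at e
    rw [kz.1, kz.2.1, kz2.1, kz2.2, ← hδ] at e
    simp only [vZ] at e
    ext
    · exact (key v).1
    · exact (key2 v).1
    · simp only [dg]
      have : (f v).w * δ = v.w := by linarith
      linear_combination (-(f v).w) * hδ2 + δ * this
    · exact (key2 v).2
    · exact (key v).2.1

/-- Now `f₂` still has to be moved. -/
theorem stage1 {h : G5} {f : V5 → V5} (hi : Iso h f) (ε : ℤ) (hε : ε = 1 ∨ ε = -1)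
    (h1 : f vE1 = vE1) (h2 : f vF1 = vF1) (h3 : f vE2 = ⟨0, ε, 0, 0, 0⟩) :
    h ∈ prodSet FF [hL2] := by
  have hε2 : ε * ε = 1 := by rcases hε with rfl | rfl <;> rfl
  have e1 := hi.2 vF2 vE1
  have e2 := hi.2 vF2 vF1
  have e3 := hi.2 vF2 vE2
  have e4 := hi.2 vF2 vF2
  rw [h1] at e1
  rw [h2] at e2
  rw [h3] at e3
  generalize hx : f vF2 = x at *
  obtain ⟨x1, x2, w, y2, y1⟩ := x
  simp [bl, vE1, vE2, vF1, vF2] at e1 e2 e3 e4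
  subst e1 e2
  have hy : y2 = ε := by linear_combination (-y2) * hε2 + ε * e3
  subst hy
  have hx2 : x2 = -y2 * w * w := by
    have : x2 * y2 + w * w = 0 := by linarith
    linear_combination y2 * this - x2 * hε2
  refine step (mkSL 1 (-y2 * w) 0 1 (by ring)) ?_
  refine stage0 (hi.L2 1 (-y2 * w) 0 1 (by ring)) y2 hε ?_ ?_ ?_ ?_
  · rw [h1]; simp [aL2, vE1]
  · rw [h2]; simp [aL2, vF1]
  · rw [h3]; simp [aL2]
  · rw [hx, hx2]
    ext <;> simp only [aL2] <;> grind

/-- Now `e₂` still has to be moved. -/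
theorem stage2 {h : G5} {f : V5 → V5} (hi : Iso h f)
    (h1 : f vE1 = vE1) (h2 : f vF1 = vF1) : h ∈ prodSet FF [hL2, hL2] := by
  have e1 := hi.2 vE2 vE1
  have e2 := hi.2 vE2 vF1
  have e3 := hi.2 vE2 vF2
  have e4 := hi.2 vE2 vE2
  rw [h1] at e1
  rw [h2] at e2
  generalize hx : f vE2 = x at *
  generalize f vF2 = z at *
  obtain ⟨x1, x2, w, y2, y1⟩ := x
  simp [bl, vE1, vE2, vF1, vF2] at e1 e2 e3 e4
  subst e1 e2
  have e4' : x2 * (-y2) = w ^ 2 := by linarith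
  have hcop : IsCoprime x2 (-y2) := by
    refine ⟨z.y2 * (x2 * z.y2 + y2 * z.x2 + 4 * w * z.w) - 4 * y2 * z.w ^ 2,
      -z.x2 * (x2 * z.y2 + y2 * z.x2 + 4 * w * z.w), ?_⟩
    linear_combination (x2 * z.y2 + y2 * z.x2 + 2 * w * z.w + 1) * e3 + 4 * z.w ^ 2 * e4'
  obtain ⟨ε, p, r, hε, k1, k2, k3⟩ : ∃ ε p r : ℤ, (ε = 1 ∨ ε = -1) ∧
      x2 = ε * p ^ 2 ∧ w = ε * (-(p * r)) ∧ y2 = ε * (-r ^ 2) := by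
    obtain ⟨a, ha⟩ : ∃ a : ℤ, x2 = a ^ 2 ∨ x2 = -a ^ 2 := Int.sq_of_isCoprime hcop e4'
    by_cases h0 : a = 0
    · have hx0 : x2 = 0 := by rcases ha with ha | ha <;> simp [ha, h0]
      have hw0 : w = 0 := by
        rw [hx0, zero_mul] at e4'
        exact pow_eq_zero_iff (two_ne_zero) |>.mp e4'.symm
      have hy : IsUnit (-y2) := by rw [hx0] at hcop; exact isCoprime_zero_left.mp hcop
      exact ⟨-y2, 0, 1, Int.isUnit_iff.mp hy, by simp [hx0], by simp [hw0], by ring⟩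
    · have hdiv : a ∣ w := by
        rw [← Int.pow_dvd_pow_iff two_ne_zero, ← e4']
        rcases ha with ha | ha
        · rw [ha]; exact dvd_mul_right _ _
        · rw [ha]; exact ⟨y2, by ring⟩
      obtain ⟨t, rfl⟩ := hdiv
      have ha2 : a ^ 2 ≠ 0 := pow_ne_zero _ h0
      rcases ha with ha | ha
      · refine ⟨1, a, -t, Or.inl rfl, by rw [ha]; ring, by ring, ?_⟩
        apply mul_left_cancel₀ ha2
        rw [ha] at e4'
        linear_combination -e4'
      · refine ⟨-1, a, t, Or.inr rfl, by rw [ha]; ring, by ring, ?_⟩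
        apply mul_left_cancel₀ ha2
        rw [ha] at e4'
        linear_combination e4'
  have hpr : IsCoprime p r := by
    obtain ⟨u, v, huv⟩ := hcop
    exact ⟨u * ε * p, v * ε * r, by rw [← huv, k1, k3]; ring⟩
  obtain ⟨s, q, hsq⟩ := hpr
  have hd : s * p - q * (-r) = 1 := by linarith
  refine step (mkSL s q (-r) p hd) ?_
  refine stage1 (hi.L2 s q (-r) p hd) ε hε ?_ ?_ ?_
  · rw [h1]; simp [aL2, vE1]
  · rw [h2]; simp [aL2, vF1]
  · rw [hx, k1, k2, k3]
    ext <;> simp only [aL2] <;> grind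

theorem stage3 {h : G5} {f : V5 → V5} (hi : Iso h f)
    (h1 : f vE1 = vE1) : h ∈ prodSet FF [hS2, hL1, hS1, hL2, hL2] := by
  have e1 := hi.2 vF1 vE1
  have e2 := hi.2 vF1 vF1
  rw [h1] at e1
  generalize hx : f vF1 = x at *
  obtain ⟨x1, x2, w, y2, y1⟩ := x
  simp [bl, vE1, vF1] at e1 e2
  subst e1
  refine step (mkSL 1 x2 0 1 (by ring)) ?_
  refine step (mkSL 1 (-w) 0 1 (by ring)) ?_
  refine step (mkSL 1 y2 0 1 (by ring)) ?_
  refine stage2 (((hi.S2 1 x2 0 1 (by ring)).L1 1 (-w) 0 1 (by ring)).S1 1 y2 0 1 (by ring)) ?_ ?_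
  · rw [h1]; simp [aS1, aS2, aL1, vE1]
  · rw [hx]
    ext <;> simp only [aS1, aS2, aL1, vF1] <;> grind

theorem stage4 {h : G5} {f : V5 → V5} (hi : Iso h f) (w y1 : ℤ)
    (h1 : f vE1 = ⟨1, 0, w, 0, y1⟩) : h ∈ prodSet FF [hL1, hS2, hL1, hS1, hL2, hL2] := by
  have e1 := hi.2 vE1 vE1
  rw [h1] at e1
  simp [bl, vE1] at e1
  refine step (mkSL 1 0 w 1 (by ring)) ?_
  refine stage3 (hi.L1 1 0 w 1 (by ring)) ?_
  rw [h1]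
  ext <;> simp only [aL1, vE1] <;> grind

theorem stage5 {h : G5} {f : V5 → V5} (hi : Iso h f) (x2 w y1 : ℤ)
    (h1 : f vE1 = ⟨1, x2, w, 0, y1⟩) : h ∈ prodSet FF [hS1, hL1, hS2, hL1, hS1, hL2, hL2] := by
  refine step (mkSL 1 0 (-x2) 1 (by ring)) ?_
  refine stage4 (hi.S1 1 0 (-x2) 1 (by ring)) w y1 ?_
  rw [h1]
  ext <;> simp only [aS1] <;> ring

theorem stage6 {h : G5} {f : V5 → V5} (hi : Iso h f) (x1 w y2 y1 : ℤ)
    (h1 : f vE1 = ⟨x1, 0, w, y2, y1⟩) (hc : IsCoprime x1 y2) :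
    h ∈ prodSet FF [hS2, hS1, hL1, hS2, hL1, hS1, hL2, hL2] := by
  obtain ⟨u, v, huv⟩ := hc
  have hd : u * x1 - v * (-y2) = 1 := by linarith
  refine step (mkSL u v (-y2) x1 hd) ?_
  refine stage5 (hi.S2 u v (-y2) x1 hd) (u * 0 - v * y1) w (x1 * y1 - (-y2) * 0) ?_
  rw [h1]
  ext <;> simp only [aS2] <;> linarith

theorem exists_coprime_shift {g y z : ℤ} (hg : g ≠ 0) (U V W : ℤ)
    (hb : U * g + V * y + W * z = 1) : ∃ k : ℤ, IsCoprime g (y + k * z) := by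
  classical
  let S := g.natAbs.primeFactors.filter fun p : ℕ => ¬ (p : ℤ) ∣ y
  refine ⟨∏ p ∈ S, (p : ℤ), ?_⟩
  rw [Int.isCoprime_iff_gcd_eq_one, ← Int.isCoprime_iff_gcd_eq_one,
    Int.isCoprime_iff_nat_coprime]
  by_contra hn
  obtain ⟨p, hp, hpg, hps⟩ := Nat.Prime.not_coprime_iff_dvd.mp hn
  have hpg' : (p : ℤ) ∣ g := Int.natCast_dvd.mpr hpg
  have hps' : (p : ℤ) ∣ y + (∏ p ∈ S, (p : ℤ)) * z := Int.natCast_dvd.mpr hps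
  have hpi : Prime (p : ℤ) := Nat.prime_iff_prime_int.mp hp
  by_cases hy : (p : ℤ) ∣ y
  · rcases hpi.dvd_or_dvd ((dvd_add_right hy).mp hps') with hk | hz
    · obtain ⟨q, hq, hpq⟩ := (Prime.dvd_finset_prod_iff hpi _).mp hk
      have hq' := Finset.mem_filter.mp hq
      have hqp := Nat.prime_of_mem_primeFactors hq'.1
      have : p = q := (Nat.prime_dvd_prime_iff_eq hp hqp).mp (Int.natCast_dvd_natCast.mp hpq)
      exact hq'.2 (this ▸ hy)
    · apply hpi.not_dvd_one
      rw [← hb]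
      exact dvd_add (dvd_add (hpg'.mul_left _) (hy.mul_left _)) (hz.mul_left _)
  · have hS : p ∈ S := Finset.mem_filter.mpr
      ⟨Nat.mem_primeFactors.mpr ⟨hp, hpg, Int.natAbs_ne_zero.mpr hg⟩, hy⟩
    have hk : (p : ℤ) ∣ ∏ p ∈ S, (p : ℤ) := Finset.dvd_prod_of_mem (fun p : ℕ => (p : ℤ)) hS
    exact hy ((dvd_add_left (hk.mul_right z)).mp hps')

theorem stage7 {h : G5} {f : V5 → V5} (hi : Iso h f) (x1 w y2 y1 : ℤ)
    (h1 : f vE1 = ⟨x1, 0, w, y2, y1⟩) :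
    h ∈ prodSet FF [hS1, hS2, hS1, hL1, hS2, hL1, hS1, hL2, hL2] := by
  have e1 := hi.2 vE1 vE1
  have e2 := hi.2 vE1 vF1
  generalize f vF1 = z at *
  rw [h1] at e1 e2
  simp [bl, vE1, vF1] at e1 e2
  obtain ⟨z1, z2, zw, t2, t1⟩ := z
  simp only at e2
  have e1' : x1 * y1 + w * w = 0 := by linarith
  by_cases hx : x1 = 0
  · subst hx
    have hw : w = 0 := by
      have : w * w = 0 := by linarith
      exact mul_self_eq_zero.mp this
    subst hw
    have hd : z2 * y2 - (-z1) * y1 = 1 := by linarith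
    refine step (mkSL z2 (-z1) y1 y2 hd) ?_
    refine stage6 (hi.S1 z2 (-z1) y1 y2 hd) 0 0 1 (y2 * y1 - y1 * y2) ?_ isCoprime_one_right
    rw [h1]
    ext <;> simp only [aS1] <;> linarith
  · obtain ⟨k, hk⟩ := exists_coprime_shift (y := y2) (z := y1) hx
      (t1 * (x1 * t1 + y1 * z1 + y2 * z2 + 4 * w * zw) - 4 * y1 * zw ^ 2)
      (z2 * (x1 * t1 + y1 * z1 + y2 * z2 + 4 * w * zw))
      (z1 * (x1 * t1 + y1 * z1 + y2 * z2 + 4 * w * zw))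
      (by linear_combination (x1 * t1 + y1 * z1 + y2 * z2 + 2 * w * zw + 1) * e2
            - 4 * zw ^ 2 * e1')
    refine step (mkSL 1 (-k) 0 1 (by ring)) ?_
    refine stage6 (hi.S1 1 (-k) 0 1 (by ring)) x1 w (y2 + k * y1) y1 ?_ hk
    rw [h1]
    ext <;> simp only [aS1] <;> ring

/-- The factorisation pattern of an arbitrary isometry. -/
def pat : List (SL2 →* G5) := [hS1, hS1, hS2, hS1, hL1, hS2, hL1, hS1, hL2, hL2]

theorem kill_second (x y : ℤ) : ∃ a b c d : ℤ, a * d - b * c = 1 ∧ c * x + d * y = 0 := by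
  rcases Nat.eq_zero_or_pos (Int.gcd x y) with h0 | h0
  · obtain ⟨rfl, rfl⟩ := Int.gcd_eq_zero_iff.mp h0
    exact ⟨1, 0, 0, 1, by ring, by ring⟩
  · obtain ⟨g, m, n, -, hmn, hx, hy⟩ := Int.exists_gcd_one' h0
    obtain ⟨u, v, huv⟩ := Int.isCoprime_iff_gcd_eq_one.mpr hmn
    exact ⟨u, v, -n, m, by linarith, by rw [hx, hy]; ring⟩

theorem stage8 {h : G5} {f : V5 → V5} (hi : Iso h f) : h ∈ prodSet FF pat := by
  generalize hx : f vE1 = x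
  obtain ⟨x1, x2, w, y2, y1⟩ := x
  obtain ⟨a, b, c, d, hd, hz⟩ := kill_second x1 x2
  refine step (mkSL a b c d hd) ?_
  refine stage7 (hi.S1 a b c d hd) (a * x1 + b * x2) w (a * y2 - b * y1) (d * y1 - c * y2) ?_
  rw [hx]
  ext <;> simp only [aS1]
  exact hz

theorem cov_iso {Γ : Subgroup G5} (H : HasAB Γ) :
    Cov (Gpp Γ) {h : G5 | ∃ f, Iso h f} := by
  have hp : ∀ φ ∈ pat, φ = hS1 ∨ φ = hS2 ∨ φ = hL1 ∨ φ = hL2 := by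
    intro φ hφ
    simp only [pat, List.mem_cons, List.not_mem_nil, or_false] at hφ
    tauto
  refine Cov.mono (cov_prod H FF_finite pat hp) le_rfl ?_
  rintro h ⟨f, hf⟩
  exact stage8 hf

end HGA

namespace HGA

/-! ### Transfer to the integral orthogonal group of `matQ` -/

/-- The adjoint partner of `Cm`. -/
def Dm : M5 := !![36, -90, -18, 72, -18; 12, -12, -24, -12, 12; 54, -18, -54, -18, 54;
  -54, 0, 54, 54, -108; -24, -12, 12, 24, 12]

/-- The Gram matrix of the split form. -/
def Jm : M5 := !![0, 0, 0, 0, 1; 0, 0, 0, 1, 0; 0, 0, 2, 0, 0; 0, 1, 0, 0, 0; 1, 0, 0, 0, 0]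

theorem Dm_Cm : Dm * Cm = (216 : ℤ) • (1 : M5) := by decide

theorem Cm_Dm : Cm * Dm = (216 : ℤ) • (1 : M5) := by decide

theorem Cm_gram : Cmᵀ * matQ * Cm = (216 : ℤ) • Jm := by decide

theorem smul_cancel {X Y : M5} (h : (216 : ℤ) • X = (216 : ℤ) • Y) : X = Y :=
  smul_right_injective M5 (by norm_num : (216 : ℤ) ≠ 0) h

theorem Cm_cancel {X Y : M5} (h : Cm * X = Cm * Y) : X = Y := by
  apply smul_cancel
  have := congrArg (fun Z => Dm * Z) h
  simpa only [← mul_assoc, Dm_Cm, Matrix.smul_mul, one_mul] using this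

theorem Cm_cancel_right {X Y : M5} (h : X * Cm = Y * Cm) : X = Y := by
  apply smul_cancel
  have := congrArg (fun Z => Z * Dm) h
  simpa only [mul_assoc, Cm_Dm, Matrix.mul_smul, mul_one] using this

theorem bl_eq (u v : V5) : bl u v = u.vec ⬝ᵥ (Jm *ᵥ v.vec) := by
  simp [bl, V5.vec, Jm, Matrix.mulVec, dotProduct, Fin.sum_univ_five]
  ring

theorem acts_exists (M : M5) : ∃ f, Acts M f :=
  ⟨fun v => ⟨(M *ᵥ v.vec) 0, (M *ᵥ v.vec) 1, (M *ᵥ v.vec) 2, (M *ᵥ v.vec) 3, (M *ᵥ v.vec) 4⟩,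
    fun v => (vec_surj _).symm⟩

theorem iso_of_gram (h : G5) (hg : (h : M5)ᵀ * Jm * (h : M5) = Jm) : ∃ f, Iso h f := by
  obtain ⟨f, hf⟩ := acts_exists (h : M5)
  refine ⟨f, hf, fun u v => ?_⟩
  rw [bl_eq, bl_eq, ← hf u, ← hf v, Matrix.mulVec_mulVec, Matrix.dotProduct_mulVec,
    Matrix.vecMul_mulVec, ← Matrix.dotProduct_mulVec]
  conv_rhs => rw [← hg]
  rw [mul_assoc]

theorem lift_one {N : M5} {X : M5} (hN : N = 1 + (216 : ℤ) • X) :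
    Cm * (1 + Dm * X * Cm) = N * Cm := by
  rw [hN, mul_add, mul_one, add_mul, one_mul, mul_assoc Dm, ← mul_assoc Cm, Cm_Dm]
  simp only [Matrix.smul_mul, one_mul]

theorem conj_exists (N : G5) (hN : N ∈ orthogonalSubgroup matQ) (X : M5)
    (hX : (N : M5) = 1 + (216 : ℤ) • X) :
    ∃ h : G5, (N : M5) * Cm = Cm * (h : M5) ∧ ∃ f, Iso h f := by
  have hX' : ((N⁻¹ : G5) : M5) = 1 + (216 : ℤ) • (-(((N⁻¹ : G5) : M5) * X)) := by
    have : ((N⁻¹ : G5) : M5) * (N : M5) = 1 := Units.inv_mul N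
    rw [hX, mul_add, mul_one, Matrix.mul_smul] at this
    rw [smul_neg, ← sub_eq_add_neg]
    exact eq_sub_of_add_eq this
  have k1 := lift_one hX
  have k2 := lift_one hX'
  generalize 1 + Dm * X * Cm = h at k1
  generalize 1 + Dm * (-(((N⁻¹ : G5) : M5) * X)) * Cm = h' at k2
  have m1 : h * h' = 1 := by
    apply Cm_cancel
    rw [← mul_assoc, k1, mul_assoc, k2, ← mul_assoc, Units.mul_inv, one_mul, mul_one]
  have m2 : h' * h = 1 := by
    apply Cm_cancel
    rw [← mul_assoc, k2, mul_assoc, k1, ← mul_assoc, Units.inv_mul, one_mul, mul_one]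
  refine ⟨⟨h, h', m1, m2⟩, k1.symm, iso_of_gram _ ?_⟩
  show hᵀ * Jm * h = Jm
  apply smul_cancel
  have hQ : (N : M5)ᵀ * matQ * (N : M5) = matQ := hN
  calc (216 : ℤ) • (hᵀ * Jm * h) = hᵀ * ((216 : ℤ) • Jm) * h := by
        rw [Matrix.mul_smul, Matrix.smul_mul]
    _ = (Cm * h)ᵀ * matQ * (Cm * h) := by
        rw [← Cm_gram, Matrix.transpose_mul]; simp only [mul_assoc]
    _ = Cmᵀ * ((N : M5)ᵀ * matQ * (N : M5)) * Cm := by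
        rw [k1, Matrix.transpose_mul]; simp only [mul_assoc]
    _ = (216 : ℤ) • Jm := by rw [hQ, Cm_gram]

/-- Reduction modulo `216`. -/
def red (s : orthogonalSubgroup matQ) : Matrix (Fin 5) (Fin 5) (ZMod 216) :=
  ((s : G5) : M5).map (Int.cast : ℤ → ZMod 216)

theorem red_eq {s t : orthogonalSubgroup matQ} (h : red s = red t) :
    ∃ X : M5, (((s : G5) * (t : G5)⁻¹ : G5) : M5) = 1 + (216 : ℤ) • X := by
  have hd : ∀ i j, ∃ y : ℤ, ((s : G5) : M5) i j - ((t : G5) : M5) i j = 216 * y := by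
    intro i j
    have := congrFun (congrFun h i) j
    simp only [red, Matrix.map_apply] at this
    exact (ZMod.intCast_eq_intCast_iff_dvd_sub _ _ 216).mp this.symm
  choose Y hY using hd
  have hs : ((s : G5) : M5) = ((t : G5) : M5) + (216 : ℤ) • (Matrix.of Y) := by
    ext i j
    simp only [Matrix.add_apply, Matrix.smul_apply, Matrix.of_apply, smul_eq_mul]
    linarith [hY i j]
  refine ⟨Matrix.of Y * (((t : G5)⁻¹ : G5) : M5), ?_⟩
  rw [Units.val_mul, hs, add_mul, Units.mul_inv, Matrix.smul_mul]

theorem finiteIndex_main {Γ : Subgroup G5} (H : HasAB Γ) :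
    (Γ.subgroupOf (orthogonalSubgroup matQ)).FiniteIndex := by
  classical
  obtain ⟨Z, hZ, hcov⟩ := cov_iso H
  have hrep : ∃ rep : Matrix (Fin 5) (Fin 5) (ZMod 216) → orthogonalSubgroup matQ,
      ∀ s, red (rep (red s)) = red s := by
    refine ⟨fun c => if hc : ∃ s, red s = c then hc.choose else 1, fun s => ?_⟩
    have hc : ∃ s', red s' = red s := ⟨s, rfl⟩
    simp only [dif_pos hc]
    exact hc.choose_spec
  obtain ⟨rep, hrep⟩ := hrep
  have hc : ∀ s : orthogonalSubgroup matQ, ∃ h : G5, ∃ z : Z,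
      (((s : G5) * (rep (red s) : G5)⁻¹ : G5) : M5) * Cm = Cm * (h : M5) ∧
      h * (z : G5)⁻¹ ∈ Gpp Γ := by
    intro s
    obtain ⟨X, hX⟩ := red_eq (hrep s).symm
    obtain ⟨h, e, hf⟩ := conj_exists _
      ((orthogonalSubgroup matQ).mul_mem s.2 ((orthogonalSubgroup matQ).inv_mem (rep (red s)).2))
      X hX
    obtain ⟨z, hz, hk⟩ := hcov h hf
    exact ⟨h, ⟨z, hz⟩, e, hk⟩
  choose hh zz e hk using hc
  have : Finite Z := hZ
  apply finiteIndex_of_coloring _ (fun s => (red s, zz s))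
  intro s t hst
  obtain ⟨h1, h2⟩ := Prod.mk.inj hst
  have hm : hh s * (hh t)⁻¹ ∈ Gpp Γ := by
    have k1 := hk s
    have k2 := hk t
    rw [← h2] at k2
    have := (Gpp Γ).mul_mem k1 ((Gpp Γ).inv_mem k2)
    simpa [mul_assoc] using this
  obtain ⟨γ, hγ, eγ⟩ := hm
  have es := e s
  have et := e t
  rw [← h1] at et
  rw [Subgroup.mem_subgroupOf]
  have : ((s * t⁻¹ : orthogonalSubgroup matQ) : G5) = γ := by
    have key : γ * ((t : G5) * (rep (red s) : G5)⁻¹) = (s : G5) * (rep (red s) : G5)⁻¹ := by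
      apply Units.ext
      apply Cm_cancel_right
      rw [Units.val_mul, mul_assoc, et, ← mul_assoc, eγ, es, Units.val_mul, mul_assoc, mul_assoc,
        Units.inv_mul, mul_one]
    rw [← mul_assoc] at key
    have := mul_right_cancel key
    rw [Subgroup.coe_mul, Subgroup.coe_inv, ← this, mul_inv_cancel_right]
  rw [this]
  exact hγ

theorem matA_orth : matAᵀ * matQ * matA = matQ := by decide

theorem matB_orth : matBᵀ * matQ * matB = matQ := by decide

end HGA

/-- Case 16 of Theorem 1.2: the hypergeometric group `Γ(f,g)` generated by the companion matrices `A`, `B`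
of `f(x) = x^5 - 3*x^4 + 5*x^3 - 5*x^2 + 3*x - 1` and `g(x) = x^5 + 2*x^4 + 3*x^3 + 3*x^2 + 2*x + 1`
is an arithmetic subgroup of `O_Q(ℤ)`: it preserves `Q`, it is contained in `O_Q(ℤ)`,
and it has finite index in `O_Q(ℤ)`. -/
theorem hypergeometric_group_arithmetic
    (A B : GL (Fin 5) ℤ)
    (hA : (A : Matrix (Fin 5) (Fin 5) ℤ) = matA)
    (hB : (B : Matrix (Fin 5) (Fin 5) ℤ) = matB) :
    matAᵀ * matQ * matA = matQ ∧
    matBᵀ * matQ * matB = matQ ∧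
    Subgroup.closure {A, B} ≤ orthogonalSubgroup matQ ∧
    ((Subgroup.closure {A, B}).subgroupOf (orthogonalSubgroup matQ)).FiniteIndex := by
  refine ⟨HGA.matA_orth, HGA.matB_orth, ?_, ?_⟩
  · rw [Subgroup.closure_le]
    rintro M (rfl | rfl)
    · show (_ : Matrix (Fin 5) (Fin 5) ℤ)ᵀ * matQ * _ = matQ
      rw [hA]
      exact HGA.matA_orth
    · show (_ : Matrix (Fin 5) (Fin 5) ℤ)ᵀ * matQ * _ = matQ
      rw [hB]
      exact HGA.matB_orth
  · exact HGA.finiteIndex_main ⟨A, Subgroup.subset_closure (by simp), B,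
      Subgroup.subset_closure (by simp), hA, hB⟩
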